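/- arXiv:2301.13377 — 3 statements merged into one kernel-verified Lean document; each statement's English description precedes it below -/
import Mathlib

section
/- Let p be a prime, n = p + i with 0 ≤ i ≤ p − 1, and S = ℤ_(p)[x_1,…,x_n] with S_n acting by permuting variables. Then the image of the transfer map Tr: S → S^{S_n} = ℤ_(p)[e_1,…,e_n] equals the ideal ⟨p, e_1e_p − e_{p+1}, e_2e_p − e_{p+2}, …, e_ie_p − e_{p+i}, e_{i+1}, …, e_{p−1}⟩. -/
open MvPolynomial

/-- The prime ideal `(p)` of `ℤ`. -/
abbrev pIdeal (p : ℕ) : Ideal ℤ := Ideal.span {(p : ℤ)}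

instance pIdeal_isPrime (p : ℕ) [hp : Fact p.Prime] : (pIdeal p).IsPrime :=
  (Ideal.span_singleton_prime (by exact_mod_cast hp.out.ne_zero)).mpr
    (Nat.prime_iff_prime_int.mp hp.out)

/-- `ℤ_(p)`, the localization of `ℤ` at the prime `p`. -/
abbrev Zp (p : ℕ) [Fact p.Prime] : Type := Localization.AtPrime (pIdeal p)

/-- The `j`-th elementary symmetric polynomial in `n` variables over `ℤ_(p)`, as an element
of the invariant ring `ℤ_(p)[e_1,…,e_n]` (the subalgebra of symmetric polynomials). -/
noncomputable def eA (p : ℕ) [Fact p.Prime] (n : ℕ) (j : ℕ) :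
    (symmetricSubalgebra (Fin n) (Zp p)) :=
  ⟨esymm (Fin n) (Zp p) j,
    (mem_symmetricSubalgebra _).mpr (esymm_isSymmetric (Fin n) (Zp p) j)⟩

open scoped Pointwise

section Transfer

lemma rename_prod_X {σ R : Type*} [DecidableEq σ] [CommRing R] (g : Equiv.Perm σ) (A : Finset σ) :
    rename g (∏ a ∈ A, X a : MvPolynomial σ R) = ∏ a ∈ g • A, X a := by
  rw [map_prod, Finset.smul_finset_def, Finset.prod_image (MulAction.injective g).injOn]
  simp

variable (σ R : Type*) [Fintype σ] [DecidableEq σ] [CommRing R]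

/-- The transfer `f ↦ ∑ g, g f` of the permutation action, linear over the invariants. -/
noncomputable def permTransfer :
    MvPolynomial σ R →ₗ[symmetricSubalgebra σ R] MvPolynomial σ R where
  toFun f := ∑ g : Equiv.Perm σ, rename g f
  map_add' f h := by simp [Finset.sum_add_distrib]
  map_smul' a f := by
    simp only [Subalgebra.smul_def, smul_eq_mul, map_mul, RingHom.id_apply, Finset.mul_sum]
    exact Finset.sum_congr rfl fun g _ => by rw [a.2 g]

/-- The image of the transfer, as an ideal of the invariant ring. -/
noncomputable def permTransferIdeal : Ideal (symmetricSubalgebra σ R) :=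
  (LinearMap.range (permTransfer σ R)).comap
    (Algebra.linearMap (symmetricSubalgebra σ R) (MvPolynomial σ R))

variable {σ R}

lemma permTransfer_apply (f : MvPolynomial σ R) :
    permTransfer σ R f = ∑ g : Equiv.Perm σ, rename g f := rfl

lemma mem_permTransferIdeal {a : symmetricSubalgebra σ R} :
    a ∈ permTransferIdeal σ R ↔ (a : MvPolynomial σ R) ∈ LinearMap.range (permTransfer σ R) :=
  Iff.rfl

lemma permTransfer_mem_symmetricSubalgebra (f : MvPolynomial σ R) :
    permTransfer σ R f ∈ symmetricSubalgebra σ R := by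
  intro e
  rw [permTransfer_apply, map_sum]
  refine Fintype.sum_equiv (Equiv.mulLeft e) _ _ fun g => ?_
  rw [rename_rename]
  rfl

lemma card_filter_smul_eq {G α : Type*} [Group G] [Fintype G] [MulAction G α] [DecidableEq α]
    (x : α) (h : G) :
    (Finset.univ.filter fun g : G => g • x = h • x).card
      = Nat.card (MulAction.stabilizer G x) := by
  rw [← Fintype.card_subtype, ← Nat.card_eq_fintype_card]
  refine Nat.card_congr ((Equiv.mulLeft h⁻¹).subtypeEquiv fun g => ?_)
  rw [MulAction.mem_stabilizer_iff, Equiv.coe_mulLeft, mul_smul, inv_smul_eq_iff]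

/-- An equivariant sum over a finite invariant set lies in the image of the transfer as soon as
the orders of all stabilizers are invertible. -/
lemma sum_mem_range_permTransfer {α : Type*} [MulAction (Equiv.Perm σ) α] [DecidableEq α]
    (F : α → MvPolynomial σ R) (hF : ∀ (g : Equiv.Perm σ) x, F (g • x) = rename g (F x))
    (s : Finset α) (hs : ∀ (g : Equiv.Perm σ), ∀ x ∈ s, g • x ∈ s)
    (hu : ∀ x ∈ s, IsUnit (Nat.card (MulAction.stabilizer (Equiv.Perm σ) x) : R)) :
    ∑ x ∈ s, F x ∈ LinearMap.range (permTransfer σ R) := by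
  induction s using Finset.strongInduction with
  | H s ih =>
    obtain rfl | ⟨x, hx⟩ := s.eq_empty_or_nonempty
    · simp
    set O : Finset α := Finset.univ.image fun g : Equiv.Perm σ => g • x with hO
    have hxO : x ∈ O := Finset.mem_image.2 ⟨1, Finset.mem_univ _, one_smul _ x⟩
    have hOs : O ⊆ s := fun y hy => by
      obtain ⟨g, -, rfl⟩ := Finset.mem_image.1 hy
      exact hs g x hx
    rw [← Finset.sum_sdiff hOs]
    refine add_mem (ih _ (Finset.sdiff_ssubset hOs ⟨x, hxO⟩) ?_ ?_) ?_
    · intro g y hy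
      rw [Finset.mem_sdiff] at hy ⊢
      refine ⟨hs g y hy.1, fun h => hy.2 ?_⟩
      obtain ⟨k, -, hk⟩ := Finset.mem_image.1 h
      refine Finset.mem_image.2 ⟨g⁻¹ * k, Finset.mem_univ _, ?_⟩
      simp only [mul_smul] at hk ⊢
      rw [hk, inv_smul_smul]
    · exact fun y hy => hu y (Finset.sdiff_subset hy)
    · obtain ⟨u, hu⟩ := hu x hx
      have key : permTransfer σ R (F x) = (u : R) • ∑ y ∈ O, F y := by
        rw [permTransfer_apply, hu, Finset.smul_sum]
        simp_rw [← hF]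
        rw [Finset.sum_comp F fun g : Equiv.Perm σ => g • x]
        refine Finset.sum_congr rfl fun y hy => ?_
        obtain ⟨g, -, rfl⟩ := Finset.mem_image.1 hy
        rw [card_filter_smul_eq, Nat.cast_smul_eq_nsmul]
      have := Submodule.smul_of_tower_mem (LinearMap.range (permTransfer σ R)) ((u⁻¹ : Rˣ) : R)
        (LinearMap.mem_range_self (permTransfer σ R) (F x))
      rwa [key, smul_smul, Units.inv_mul, one_smul] at this

lemma support_subset_or_disjoint_of_smul_eq {g : Equiv.Perm σ} (hg : g.IsCycle) {A : Finset σ}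
    (hA : g • A = A) : g.support ⊆ A ∨ Disjoint g.support A := by
  by_contra! h
  obtain ⟨h₁, h₂⟩ := h
  obtain ⟨x, hx, hxA⟩ := Finset.not_subset.1 h₁
  obtain ⟨y, hy, hyA⟩ := Finset.not_disjoint_iff.1 h₂
  obtain ⟨k, hk⟩ := hg.exists_zpow_eq (Equiv.Perm.mem_support.1 hy) (Equiv.Perm.mem_support.1 hx)
  have : g ^ k ∈ MulAction.stabilizer (Equiv.Perm σ) A :=
    zpow_mem (MulAction.mem_stabilizer_iff.2 hA) k
  apply hxA
  rw [← MulAction.mem_stabilizer_iff.1 this, ← hk]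
  exact Finset.smul_mem_smul_finset hyA

/-- The sum over disjoint pairs in the product `e_j e_k` counts `e_{j+k}` with a binomial
multiplicity. -/
lemma sum_disjoint_pairs (j k : ℕ) :
    ∑ x ∈ (Finset.powersetCard j (Finset.univ : Finset σ) ×ˢ
        Finset.powersetCard k (Finset.univ : Finset σ)).filter fun x => Disjoint x.1 x.2,
      ((∏ a ∈ x.1, X a) * ∏ b ∈ x.2, X b : MvPolynomial σ R)
      = ((k + j).choose k : MvPolynomial σ R) * esymm σ R (k + j) := by
  have h : ((k + j).choose k : MvPolynomial σ R) * esymm σ R (k + j)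
      = ∑ U ∈ Finset.powersetCard (k + j) (Finset.univ : Finset σ),
          ∑ _B ∈ Finset.powersetCard k U, ∏ a ∈ U, (X a : MvPolynomial σ R) := by
    rw [esymm, Finset.mul_sum]
    refine Finset.sum_congr rfl fun U hU => ?_
    rw [Finset.sum_const, Finset.card_powersetCard, (Finset.mem_powersetCard.1 hU).2,
      nsmul_eq_mul]
  rw [h, Finset.sum_sigma']
  refine Finset.sum_nbij' (fun x => ⟨x.1 ∪ x.2, x.2⟩) (fun y => (y.1 \ y.2, y.2)) ?_ ?_ ?_ ?_ ?_
  · rintro ⟨A, B⟩ hx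
    simp only [Finset.mem_filter, Finset.mem_product, Finset.mem_powersetCard_univ] at hx
    simp [Finset.card_union_of_disjoint hx.2, hx.1.1, hx.1.2, add_comm]
  · rintro ⟨U, B⟩ hx
    simp only [Finset.mem_sigma, Finset.mem_powersetCard, Finset.subset_univ, true_and] at hx
    simp only [Finset.mem_filter, Finset.mem_product, Finset.mem_powersetCard_univ]
    refine ⟨⟨?_, hx.2.2⟩, Finset.sdiff_disjoint⟩
    rw [Finset.card_sdiff_of_subset hx.2.1, hx.1, hx.2.2, Nat.add_sub_cancel_left]
  · rintro ⟨A, B⟩ hx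
    have := (Finset.mem_filter.1 hx).2
    simp [Finset.union_sdiff_cancel_right this]
  · rintro ⟨U, B⟩ hx
    simp only [Finset.mem_sigma, Finset.mem_powersetCard] at hx
    simp [Finset.sdiff_union_of_subset hx.2.1]
  · rintro ⟨A, B⟩ hx
    exact (Finset.prod_union (Finset.mem_filter.1 hx).2).symm

end Transfer

/-- The elementary symmetric polynomial as an element of the invariant ring. -/
noncomputable def esymmInv (σ R : Type*) [Fintype σ] [CommRing R] (j : ℕ) :
    symmetricSubalgebra σ R :=
  ⟨esymm σ R j, esymm_isSymmetric σ R j⟩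

section Generators

variable {R : Type*} [CommRing R] {p i : ℕ} [Fact p.Prime]

lemma choose_add_self_modEq_one {j : ℕ} (hj : j < p) : (p + j).choose p ≡ 1 [MOD p] := by
  have hp := (Fact.out : p.Prime).pos
  have := Choose.choose_modEq_choose_mod_mul_choose_div_nat (n := p + j) (k := p) (p := p)
  rwa [Nat.add_mod_left, Nat.mod_eq_of_lt hj, Nat.mod_self, Nat.add_div_left _ hp,
    Nat.div_eq_of_lt hj, Nat.div_self hp, Nat.choose_zero_right] at this

/-- With fewer than `2p` points, a stabilizer containing no `p`-cycle has invertible order. -/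
lemma isUnit_card_stabilizer (hi : i < p) (hR : ∀ m : ℕ, ¬ p ∣ m → IsUnit (m : R))
    {α : Type*} [MulAction (Equiv.Perm (Fin (p + i))) α] {x : α}
    (h : ∀ g : Equiv.Perm (Fin (p + i)), g.IsCycle → g.support.card = p → g • x ≠ x) :
    IsUnit (Nat.card (MulAction.stabilizer (Equiv.Perm (Fin (p + i))) x) : R) := by
  refine hR _ fun hdvd => ?_
  obtain ⟨⟨g, hg⟩, ho⟩ := exists_prime_orderOf_dvd_card' p hdvd
  rw [Subgroup.orderOf_mk] at ho
  have hc : g.IsCycle := by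
    refine Equiv.Perm.isCycle_of_prime_order' (ho.symm ▸ (Fact.out : p.Prime)) ?_
    rw [ho, Fintype.card_fin]
    omega
  exact h g hc (hc.orderOf ▸ ho) hg

lemma natCast_mem_permTransferIdeal (hi : i < p) (hR : ∀ m : ℕ, ¬ p ∣ m → IsUnit (m : R)) :
    ((p : ℕ) : symmetricSubalgebra (Fin (p + i)) R) ∈ permTransferIdeal (Fin (p + i)) R := by
  have hp : p.Prime := Fact.out
  set m := (p + i).choose p * (p - 1).factorial * i.factorial with hm
  have hfac : (p + i).factorial = m * p := by
    rw [← Nat.add_choose_mul_factorial_mul_factorial, hm, ← Nat.mul_factorial_pred hp.ne_zero,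
      Nat.choose_symm_add]
    ring
  have hpm : ¬ p ∣ m := by
    rw [hm, hp.dvd_mul, hp.dvd_mul, hp.dvd_factorial, hp.dvd_factorial]
    have h1 : ¬ p ∣ (p + i).choose p := fun h =>
      hp.one_lt.ne' (Nat.dvd_one.1 ((choose_add_self_modEq_one hi).dvd_iff dvd_rfl |>.1 h))
    have := hp.pos
    rintro ((h | h) | h)
    · exact h1 h
    · omega
    · omega
  obtain ⟨u, hu⟩ := hR m hpm
  have key : permTransfer (Fin (p + i)) R 1 = (u : R) • (p : MvPolynomial (Fin (p + i)) R) := by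
    simp [permTransfer_apply, Fintype.card_perm, hfac, hu, Nat.cast_smul_eq_nsmul]
  have := Submodule.smul_of_tower_mem (LinearMap.range (permTransfer (Fin (p + i)) R))
    ((u⁻¹ : Rˣ) : R) (LinearMap.mem_range_self (permTransfer (Fin (p + i)) R) 1)
  rw [key, smul_smul, Units.inv_mul, one_smul] at this
  simpa [mem_permTransferIdeal] using this

lemma esymmInv_mem_permTransferIdeal (hi : i < p) (hR : ∀ m : ℕ, ¬ p ∣ m → IsUnit (m : R))
    {j : ℕ} (hij : i < j) (hjp : j < p) :
    esymmInv (Fin (p + i)) R j ∈ permTransferIdeal (Fin (p + i)) R := by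
  change esymm (Fin (p + i)) R j ∈ LinearMap.range (permTransfer (Fin (p + i)) R)
  rw [esymm]
  refine sum_mem_range_permTransfer (R := R)
    (fun A : Finset (Fin (p + i)) => ∏ a ∈ A, X a)
    (fun g A => (rename_prod_X g A).symm) _ ?_ ?_
  · intro g A hA
    simpa using hA
  · intro A hA
    rw [Finset.mem_powersetCard_univ] at hA
    refine isUnit_card_stabilizer hi hR fun g hg hgp hgA => ?_
    obtain h | h := support_subset_or_disjoint_of_smul_eq hg hgA
    · have := Finset.card_le_card h
      omega
    · have := (Finset.card_union_of_disjoint h).symm.trans_le (Finset.card_le_univ _)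
      rw [Fintype.card_fin] at this
      omega

lemma esymmInv_mul_sub_mem_permTransferIdeal (hi : i < p)
    (hR : ∀ m : ℕ, ¬ p ∣ m → IsUnit (m : R)) {j : ℕ} (hji : j ≤ i) :
    esymmInv (Fin (p + i)) R j * esymmInv (Fin (p + i)) R p - esymmInv (Fin (p + i)) R (p + j)
      ∈ permTransferIdeal (Fin (p + i)) R := by
  have hjp := hji.trans_lt hi
  set F : Finset (Fin (p + i)) × Finset (Fin (p + i)) → MvPolynomial (Fin (p + i)) R :=
    fun x => (∏ a ∈ x.1, X a) * ∏ b ∈ x.2, X b with hF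
  set P := Finset.powersetCard j (Finset.univ : Finset (Fin (p + i))) ×ˢ
    Finset.powersetCard p (Finset.univ : Finset (Fin (p + i))) with hP
  have hmem : ∑ x ∈ P.filter (fun x => ¬ Disjoint x.1 x.2), F x
      ∈ LinearMap.range (permTransfer (Fin (p + i)) R) := by
    refine sum_mem_range_permTransfer F ?_ _ ?_ ?_
    · rintro g ⟨A, B⟩
      simp only [hF, map_mul, rename_prod_X, Prod.smul_mk]
    · rintro g ⟨A, B⟩ hx
      rw [Prod.smul_mk, Finset.mem_filter, Finset.smul_finset_def, Finset.smul_finset_def,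
        Finset.disjoint_image (MulAction.injective g)]
      simpa [hP, Finset.card_image_of_injective _ g.injective] using hx
    · rintro ⟨A, B⟩ hx
      simp only [hP, Finset.mem_filter, Finset.mem_product, Finset.mem_powersetCard_univ] at hx
      obtain ⟨⟨hA, hB⟩, hAB⟩ := hx
      refine isUnit_card_stabilizer hi hR fun g hg hgp hgx => hAB ?_
      rw [Prod.smul_mk, Prod.mk.injEq] at hgx
      have h1 : Disjoint g.support A := by
        refine (support_subset_or_disjoint_of_smul_eq hg hgx.1).resolve_left fun h => ?_
        have := Finset.card_le_card h
        omega
      have h2 : g.support ⊆ B := by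
        refine (support_subset_or_disjoint_of_smul_eq hg hgx.2).resolve_right fun h => ?_
        have := (Finset.card_union_of_disjoint h).symm.trans_le (Finset.card_le_univ _)
        rw [Fintype.card_fin] at this
        omega
      rw [← Finset.eq_of_subset_of_card_le h2 (by omega)]
      exact h1.symm
  have hprod : esymm (Fin (p + i)) R j * esymm (Fin (p + i)) R p
      = ((p + j).choose p : MvPolynomial (Fin (p + i)) R) * esymm (Fin (p + i)) R (p + j)
        + ∑ x ∈ P.filter (fun x => ¬ Disjoint x.1 x.2), F x := by
    rw [← sum_disjoint_pairs, Finset.sum_filter_add_sum_filter_not, Finset.sum_product, esymm,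
      esymm, Finset.sum_mul_sum]
  obtain ⟨c, hc⟩ := (Nat.modEq_iff_dvd' (Nat.choose_pos (Nat.le_add_right p j))).1
    (choose_add_self_modEq_one hjp).symm
  have hc' : (p + j).choose p = p * c + 1 := by
    have := Nat.choose_pos (Nat.le_add_right p j)
    omega
  have hpm : (p : symmetricSubalgebra (Fin (p + i)) R) * (c * esymmInv (Fin (p + i)) R (p + j))
      ∈ permTransferIdeal (Fin (p + i)) R :=
    Ideal.mul_mem_right _ _ (natCast_mem_permTransferIdeal hi hR)
  rw [mem_permTransferIdeal] at hpm ⊢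
  convert! add_mem hpm hmem using 1
  simp only [esymmInv, AddSubgroupClass.coe_sub, MulMemClass.coe_mul, hprod, hc']
  push_cast
  ring

end Generators

section Restriction

lemma sum_eq_zero_of_invariant {G M : Type*} [Group G] [Fintype G] [CommRing M] (p : ℕ)
    [CharP M p] (H : Subgroup G) (hH : p ∣ Nat.card H) (F : G → M)
    (hF : ∀ g, ∀ h ∈ H, F (h * g) = F g) : ∑ g, F g = 0 := by
  classical
  set π : G → Quotient (QuotientGroup.rightRel H) := Quotient.mk _ with hπ
  have hF' : ∀ g, F g = F (π g).out := fun g => by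
    have h : (π g).out * g⁻¹ ∈ H :=
      QuotientGroup.rightRel_apply.1 (Quotient.exact (Quotient.out_eq (π g)).symm)
    rw [← hF g _ h, inv_mul_cancel_right]
  have hcard : ∀ g₀ : G, (Finset.univ.filter fun g : G => π g = π g₀).card = Nat.card H := by
    intro g₀
    rw [← Fintype.card_subtype, ← Nat.card_eq_fintype_card]
    refine Nat.card_congr ((Equiv.mulRight g₀⁻¹).subtypeEquiv fun g => ?_)
    rw [Equiv.coe_mulRight, ← QuotientGroup.rightRel_apply, hπ, Quotient.eq, Setoid.comm']
  calc ∑ g, F g = ∑ g, F (π g).out := Finset.sum_congr rfl fun g _ => hF' g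
    _ = _ := Finset.sum_comp (fun q => F q.out) π
    _ = 0 := Finset.sum_eq_zero fun q hq => by
      obtain ⟨g₀, -, rfl⟩ := Finset.mem_image.1 hq
      rw [hcard, nsmul_eq_mul, (CharP.cast_eq_zero_iff M p _).2 hH, zero_mul]

variable (R : Type*) [CommRing R] (p i : ℕ)

/-- The polynomial ring over `R / p` in `y_1, …, y_i` and one further variable `t`. -/
abbrev RestrictionRing : Type _ :=
  Polynomial (MvPolynomial (Fin i) (R ⧸ Ideal.span {(p : R)}))

/-- The point whose first `p` coordinates are all `t`, followed by `y_1, …, y_i`. -/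
noncomputable def diagonalPoint : Fin (p + i) → RestrictionRing R p i :=
  Fin.append (fun _ => Polynomial.X) fun l => Polynomial.C (X l)

/-- Reduction modulo `p` and restriction to the locus `x_1 = ⋯ = x_p`. -/
noncomputable def diagonalRestriction :
    MvPolynomial (Fin (p + i)) R →ₐ[R] RestrictionRing R p i :=
  aeval (diagonalPoint R p i)

variable {R p i}

lemma diagonalPoint_viaEmbedding (g : Equiv.Perm (Fin p)) (k : Fin (p + i)) :
    diagonalPoint R p i (g.viaEmbedding (Fin.castAddEmb i) k)
      = diagonalPoint R p i k := by
  induction k using Fin.addCases with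
  | left k =>
    have := g.viaEmbedding_apply (Fin.castAddEmb i) k
    rw [Fin.castAddEmb_apply, Fin.castAddEmb_apply] at this
    rw [this, diagonalPoint, Fin.append_left, Fin.append_left]
  | right k =>
    rw [g.viaEmbedding_apply_of_notMem]
    rintro ⟨l, hl⟩
    have := congrArg Fin.val hl
    simp at this
    omega

/-- The subring of the invariants generated by `e_1, …, e_i, e_p`, parametrized by polynomials. -/
noncomputable def lowInvariants (R : Type*) [CommRing R] (p i : ℕ) :
    Polynomial (MvPolynomial (Fin i) R) →+* symmetricSubalgebra (Fin (p + i)) R :=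
  Polynomial.eval₂RingHom
    (aeval fun l : Fin i => esymmInv (Fin (p + i)) R (l + 1)).toRingHom
    (esymmInv (Fin (p + i)) R p)

lemma mk_comp_lowInvariants_surjective
    {J : Ideal (symmetricSubalgebra (Fin (p + i)) R)}
    (hmid : ∀ j, i < j → j < p → esymmInv (Fin (p + i)) R j ∈ J)
    (hhigh : ∀ j, 1 ≤ j → j ≤ i →
      esymmInv (Fin (p + i)) R j * esymmInv (Fin (p + i)) R p - esymmInv (Fin (p + i)) R (p + j)
        ∈ J) :
    Function.Surjective ((Ideal.Quotient.mk J).comp (lowInvariants R p i)) := by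
  set Θ := (Ideal.Quotient.mk J).comp (lowInvariants R p i) with hΘ
  have hlow : ∀ j, 1 ≤ j → j ≤ i → Ideal.Quotient.mk J (esymmInv _ R j) ∈ Θ.range := by
    intro j h1 hj
    refine ⟨Polynomial.C (X ⟨j - 1, by omega⟩), ?_⟩
    simp [hΘ, lowInvariants, Nat.sub_add_cancel h1]
  have hself : Ideal.Quotient.mk J (esymmInv _ R p) ∈ Θ.range :=
    ⟨Polynomial.X, by simp [hΘ, lowInvariants]⟩
  rw [← RingHom.range_eq_top, eq_top_iff]
  rintro a -
  obtain ⟨a, rfl⟩ := Ideal.Quotient.mk_surjective a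
  obtain ⟨q, rfl⟩ := esymmAlgHom_fin_surjective R le_rfl a
  induction q using MvPolynomial.induction_on with
  | C r => exact ⟨Polynomial.C (C r), by simp [hΘ, lowInvariants]⟩
  | add a b ha hb => rw [map_add, map_add]; exact add_mem ha hb
  | mul_X a l ha =>
    rw [map_mul, map_mul]
    refine mul_mem ha ?_
    have hl : esymmAlgHom (Fin (p + i)) R (p + i) (X l) = esymmInv (Fin (p + i)) R (l + 1) := by
      rw [esymmAlgHom, aeval_X, esymmInv]
    rw [hl]
    have := l.2
    obtain h | h := le_or_gt (l + 1 : ℕ) i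
    · exact hlow _ (by omega) h
    obtain h' | h' | h' := lt_trichotomy (l + 1 : ℕ) p
    · rw [Ideal.Quotient.eq_zero_iff_mem.2 (hmid _ h h')]
      exact zero_mem _
    · rw [h']
      exact hself
    · obtain ⟨j, hj⟩ := Nat.exists_eq_add_of_lt h'
      have hj' := hhigh (j + 1) (by omega) (by omega)
      rw [hj, add_assoc, ← (Ideal.Quotient.mk_eq_mk_iff_sub_mem _ _).2 hj', map_mul]
      exact mul_mem (hlow _ (by omega) (by omega)) hself

variable [Fact p.Prime] [CharP (R ⧸ Ideal.span {(p : R)}) p]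

lemma diagonalRestriction_permTransfer (f : MvPolynomial (Fin (p + i)) R) :
    diagonalRestriction R p i (permTransfer (Fin (p + i)) R f) = 0 := by
  rw [permTransfer_apply, map_sum]
  refine sum_eq_zero_of_invariant (M := RestrictionRing R p i) p
    (Equiv.Perm.viaEmbeddingHom (Fin.castAddEmb (n := p) i)).range ?_ _ ?_
  · rw [← Nat.card_congr
      (MonoidHom.ofInjective (Equiv.Perm.viaEmbeddingHom_injective
        (Fin.castAddEmb (n := p) i))).toEquiv,
      Nat.card_perm, Nat.card_fin]
    exact Nat.dvd_factorial (Fact.out : p.Prime).pos le_rfl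
  · rintro g _ ⟨h, rfl⟩
    rw [diagonalRestriction, aeval_rename, aeval_rename]
    congr 2
    funext k
    exact diagonalPoint_viaEmbedding h (g k)

lemma diagonalRestriction_esymm {j : ℕ} (hj : j ≤ p + i) :
    diagonalRestriction R p i (esymm (Fin (p + i)) R j)
      = ((Polynomial.X ^ p + Polynomial.C (Polynomial.X ^ p)) *
          (((Finset.univ.val.map fun l : Fin i =>
              (X l : MvPolynomial (Fin i) (R ⧸ Ideal.span {(p : R)}))).map fun r =>
                Polynomial.X + Polynomial.C r).prod).map Polynomial.C).coeff (p + i - j) := by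
  have h := Multiset.prod_X_add_C_coeff (Finset.univ.val.map (diagonalPoint R p i))
    (k := p + i - j) (by simp)
  rw [Multiset.card_map, Finset.card_val, Finset.card_univ, Fintype.card_fin,
    Nat.sub_sub_self hj] at h
  rw [diagonalRestriction, aeval_esymm_eq_multiset_esymm, ← h, Multiset.map_map]
  congr 1
  change ∏ k, _ = _
  rw [Fin.prod_univ_add, Multiset.map_map]
  congr 1
  · simp only [Function.comp_apply, diagonalPoint, Fin.append_left, Finset.prod_const,
      Finset.card_univ, Fintype.card_fin]
    rw [add_pow_char, Polynomial.C_pow]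
  · change _ = Polynomial.map _ (∏ k : Fin i, _)
    simp [Polynomial.map_prod, diagonalPoint, Fin.append_right]

lemma coeff_prod_X_add_C_X {A : Type*} [CommRing A] {j : ℕ} (hj : j ≤ i) :
    ((Finset.univ.val.map fun l : Fin i => (X l : MvPolynomial (Fin i) A)).map fun r =>
      Polynomial.X + Polynomial.C r).prod.coeff (i - j) = esymm (Fin i) A j := by
  rw [Multiset.prod_X_add_C_coeff _ (by simp), Multiset.card_map, Finset.card_val,
    Finset.card_univ, Fintype.card_fin, Nat.sub_sub_self hj, esymm_eq_multiset_esymm]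

lemma coeff_prod_X_add_C_X_of_lt {A : Type*} [CommRing A] {k : ℕ} (hk : i < k) :
    ((Finset.univ.val.map fun l : Fin i => (X l : MvPolynomial (Fin i) A)).map fun r =>
      Polynomial.X + Polynomial.C r).prod.coeff k = 0 := by
  refine Polynomial.coeff_eq_zero_of_natDegree_lt (lt_of_le_of_lt ?_ hk)
  nontriviality A
  refine (Polynomial.natDegree_multiset_prod_le _).trans ?_
  simp [Function.comp_def]

lemma diagonalRestriction_esymm_of_le (hi : i < p) {j : ℕ} (hj : j ≤ i) :
    diagonalRestriction R p i (esymm (Fin (p + i)) R j)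
      = Polynomial.C (esymm (Fin i) (R ⧸ Ideal.span {(p : R)}) j) := by
  rw [diagonalRestriction_esymm (by omega), show p + i - j = (i - j) + p by omega, add_mul,
    Polynomial.coeff_add, Polynomial.coeff_X_pow_mul, Polynomial.coeff_C_mul,
    Polynomial.coeff_map, Polynomial.coeff_map, coeff_prod_X_add_C_X hj,
    coeff_prod_X_add_C_X_of_lt (by omega), map_zero, mul_zero, add_zero]

lemma diagonalRestriction_esymm_self (hi : i < p) :
    diagonalRestriction R p i (esymm (Fin (p + i)) R p) = Polynomial.X ^ p := by
  rw [diagonalRestriction_esymm (by omega), Nat.add_sub_cancel_left, add_mul,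
    Polynomial.coeff_add, Polynomial.coeff_X_pow_mul', if_neg (by omega), Polynomial.coeff_C_mul,
    Polynomial.coeff_map]
  have := coeff_prod_X_add_C_X (A := R ⧸ Ideal.span {(p : R)}) (Nat.zero_le i)
  rw [Nat.sub_zero, esymm_zero] at this
  rw [this, map_one, mul_one, zero_add]

lemma diagonalRestriction_aeval_esymmInv (hi : i < p) (a : MvPolynomial (Fin i) R) :
    diagonalRestriction R p i
        (aeval (fun l : Fin i => esymmInv (Fin (p + i)) R (l + 1)) a :
          symmetricSubalgebra (Fin (p + i)) R)
      = Polynomial.C (aeval (fun l : Fin i => esymm (Fin i) (R ⧸ Ideal.span {(p : R)}) (l + 1))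
          (MvPolynomial.map (Ideal.Quotient.mk (Ideal.span {(p : R)})) a)) := by
  rw [← Subalgebra.mvPolynomial_aeval_coe]
  induction a using MvPolynomial.induction_on with
  | C r =>
    rw [MvPolynomial.map_C, aeval_C, aeval_C, AlgHom.commutes]
    rfl
  | add a b ha hb => rw [map_add, map_add, ha, hb, map_add, map_add, map_add]
  | mul_X a l ha =>
    rw [map_mul, map_mul, ha, map_mul, map_mul, map_mul, MvPolynomial.map_X, aeval_X, aeval_X]
    exact congrArg _ (diagonalRestriction_esymm_of_le (R := R) hi (Nat.succ_le_of_lt l.2))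

lemma diagonalRestriction_lowInvariants (hi : i < p) (P : Polynomial (MvPolynomial (Fin i) R)) :
    diagonalRestriction R p i (lowInvariants R p i P)
      = Polynomial.expand _ p
          ((P.map (MvPolynomial.map (Ideal.Quotient.mk (Ideal.span {(p : R)})))).map
          (aeval fun l : Fin i => esymm (Fin i) (R ⧸ Ideal.span {(p : R)}) (l + 1)).toRingHom) := by
  induction P using Polynomial.induction_on' with
  | add P Q hP hQ => rw [map_add, AddMemClass.coe_add, map_add, hP, hQ, Polynomial.map_add,
      Polynomial.map_add, map_add]
  | monomial n a =>
    rw [← Polynomial.C_mul_X_pow_eq_monomial, map_mul, map_pow, MulMemClass.coe_mul,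
      SubmonoidClass.coe_pow, map_mul, map_pow, Polynomial.map_mul, Polynomial.map_mul,
      Polynomial.map_pow, Polynomial.map_pow, Polynomial.map_X, Polynomial.map_X, Polynomial.map_C,
      Polynomial.map_C, map_mul, map_pow, Polynomial.expand_X, Polynomial.expand_C, lowInvariants,
      Polynomial.coe_eval₂RingHom, Polynomial.eval₂_C, Polynomial.eval₂_X]
    exact congrArg₂ (· * ·) (diagonalRestriction_aeval_esymmInv hi a)
      (congrArg (· ^ n) (diagonalRestriction_esymm_self hi))

lemma lowInvariants_mem_span (hi : i < p) {P : Polynomial (MvPolynomial (Fin i) R)}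
    (hP : diagonalRestriction R p i (lowInvariants R p i P) = 0) :
    lowInvariants R p i P
      ∈ Ideal.span {((p : ℕ) : symmetricSubalgebra (Fin (p + i)) R)} := by
  have hinj : Function.Injective
      (aeval fun l : Fin i => esymm (Fin i) (R ⧸ Ideal.span {(p : R)}) (l + 1) :
        MvPolynomial (Fin i) _ →ₐ[R ⧸ Ideal.span {(p : R)}] MvPolynomial (Fin i) _).toRingHom := fun a b hab =>
    esymmAlgHom_fin_injective _ le_rfl (Subtype.ext (by
      rw [esymmAlgHom_apply, esymmAlgHom_apply]
      exact hab))
  rw [diagonalRestriction_lowInvariants hi] at hP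
  have h0 : P.map (MvPolynomial.map (Ideal.Quotient.mk (Ideal.span {(p : R)}))) = 0 := by
    apply Polynomial.map_injective _ hinj
    apply Polynomial.expand_injective (Fact.out : p.Prime).pos
    rw [hP, Polynomial.map_zero, map_zero]
  have h1 : P ∈ Ideal.span {((p : ℕ) : Polynomial (MvPolynomial (Fin i) R))} := by
    have : P ∈ RingHom.ker (Polynomial.mapRingHom
        (MvPolynomial.map (σ := Fin i) (Ideal.Quotient.mk (Ideal.span {(p : R)})))) := h0
    simpa [Polynomial.ker_mapRingHom, MvPolynomial.ker_map, Ideal.map_span] using this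
  have := Ideal.mem_map_of_mem (lowInvariants R p i) h1
  simpa [Ideal.map_span] using this

lemma permTransferIdeal_le (hi : i < p)
    {J : Ideal (symmetricSubalgebra (Fin (p + i)) R)}
    (hJ : J ≤ permTransferIdeal (Fin (p + i)) R) (hpJ : ((p : ℕ) : symmetricSubalgebra _ R) ∈ J)
    (hmid : ∀ j, i < j → j < p → esymmInv (Fin (p + i)) R j ∈ J)
    (hhigh : ∀ j, 1 ≤ j → j ≤ i →
      esymmInv (Fin (p + i)) R j * esymmInv (Fin (p + i)) R p - esymmInv (Fin (p + i)) R (p + j)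
        ∈ J) :
    permTransferIdeal (Fin (p + i)) R ≤ J := by
  intro a ha
  obtain ⟨P, hP⟩ := mk_comp_lowInvariants_surjective hmid hhigh (Ideal.Quotient.mk J a)
  have haP := (Ideal.Quotient.mk_eq_mk_iff_sub_mem _ _).1 hP
  have hPI : lowInvariants R p i P ∈ permTransferIdeal (Fin (p + i)) R := by
    simpa using add_mem (hJ haP) ha
  obtain ⟨f, hf⟩ := mem_permTransferIdeal.1 hPI
  have hPJ : lowInvariants R p i P ∈ J :=
    (Ideal.span_singleton_le_iff_mem J).2 hpJ
      (lowInvariants_mem_span hi (by rw [← hf, diagonalRestriction_permTransfer]))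
  simpa using sub_mem hPJ haP

end Restriction

lemma isUnit_natCast_Zp_iff (p : ℕ) [Fact p.Prime] (m : ℕ) : IsUnit (m : Zp p) ↔ ¬ p ∣ m := by
  have := IsLocalization.AtPrime.isUnit_to_map_iff (Zp p) (pIdeal p) (m : ℤ)
  rw [map_natCast] at this
  rw [this, Ideal.mem_primeCompl_iff, Ideal.mem_span_singleton, Int.natCast_dvd_natCast]

/-- Main Theorem: Let `p` be a prime and `n = p + i` with `0 ≤ i ≤ p − 1`,
and let `S_n` act on `S = ℤ_(p)[x_1,…,x_n]` by permuting variables.  Then the image of the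
transfer map `Tr : S → S^{S_n} = ℤ_(p)[e_1,…,e_n]` equals the ideal
`⟨p, e_1e_p − e_{p+1}, …, e_ie_p − e_{p+i}, e_{i+1}, …, e_{p−1}⟩`. -/
theorem image_transfer_eq_ideal (p : ℕ) [Fact p.Prime] (i : ℕ) (hi : i ≤ p - 1) :
    {x : MvPolynomial (Fin (p + i)) (Zp p) |
        ∃ f, ∑ σ : Equiv.Perm (Fin (p + i)), rename (⇑σ) f = x} =
      Subtype.val ''
        (↑(Ideal.span
            (({((p : ℕ) : symmetricSubalgebra (Fin (p + i)) (Zp p))} : Set _) ∪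
             ((fun j => eA p (p + i) j * eA p (p + i) p - eA p (p + i) (p + j)) ''
                Set.Icc 1 i) ∪
             ((fun j => eA p (p + i) j) '' Set.Icc (i + 1) (p - 1)))) :
          Set (symmetricSubalgebra (Fin (p + i)) (Zp p))) := by
  have hp : p.Prime := Fact.out
  have hip : i < p := by
    have := hp.pos
    omega
  have hR : ∀ m : ℕ, ¬ p ∣ m → IsUnit (m : Zp p) := fun m => (isUnit_natCast_Zp_iff p m).2
  have : CharP (Zp p ⧸ Ideal.span {(p : Zp p)}) p :=
    CharP.quotient _ _ fun h => (isUnit_natCast_Zp_iff p p).1 h dvd_rfl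
  have hset : {x : MvPolynomial (Fin (p + i)) (Zp p) |
      ∃ f, ∑ σ : Equiv.Perm (Fin (p + i)), rename (⇑σ) f = x} =
      Subtype.val '' (permTransferIdeal (Fin (p + i)) (Zp p) : Set (symmetricSubalgebra _ _)) := by
    ext x
    constructor
    · rintro ⟨f, rfl⟩
      exact ⟨⟨_, permTransfer_mem_symmetricSubalgebra f⟩, ⟨f, rfl⟩, rfl⟩
    · rintro ⟨_, ⟨f, hf⟩, rfl⟩
      exact ⟨f, hf⟩
  rw [hset]
  congr 2
  refine le_antisymm (permTransferIdeal_le hip ?_ ?_ ?_ ?_) ?_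
  rotate_left
  · exact Ideal.subset_span (Or.inl (Or.inl rfl))
  · exact fun j h1 h2 => Ideal.subset_span (Or.inr ⟨j, ⟨h1, by omega⟩, rfl⟩)
  · exact fun j h1 h2 => Ideal.subset_span (Or.inl (Or.inr ⟨j, ⟨h1, h2⟩, rfl⟩))
  all_goals
    rw [Ideal.span_le]
    rintro _ ((rfl | ⟨j, hj, rfl⟩) | ⟨j, hj, rfl⟩)
    · exact natCast_mem_permTransferIdeal hip hR
    · exact esymmInv_mul_sub_mem_permTransferIdeal hip hR hj.2
    · exact esymmInv_mem_permTransferIdeal hip hR hj.1 (by have := hj.2; have := hp.pos; omega)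
end

section
/- Let p be prime and n = p + i with 0 ≤ i ≤ p − 1. The generators p, e_1e_p − e_{p+1}, …, e_ie_p − e_{p+i}, e_{i+1}, …, e_{p−1} form a regular sequence in ℤ_(p)[e_1,…,e_n], and the resulting ideal is prime of height p. -/
open MvPolynomial

/-- The variable `e_j` (for `1 ≤ j ≤ n`) of the polynomial ring
`ℤ_(p)[e_1,…,e_n]`, realized as `MvPolynomial (Fin n) ℤ_(p)` with `e_j = X (j-1)`. -/
noncomputable def eVar (p : ℕ) [Fact p.Prime] (n : ℕ) (j : ℕ) :
    MvPolynomial (Fin n) (Zp p) :=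
  if h : 1 ≤ j ∧ j ≤ n then X ⟨j - 1, by omega⟩ else 0

/-- Every proper initial segment of the list generates a prime ideal not containing the next
element, and the whole list generates a prime ideal. -/
def IsPrimeChain {R : Type*} [CommRing R] (rs : List R) : Prop :=
  (∀ k, (Ideal.ofList (rs.take k)).IsPrime) ∧
    ∀ k (h : k < rs.length), rs[k] ∉ Ideal.ofList (rs.take k)

namespace IsPrimeChain

variable {R S : Type*} [CommRing R] [CommRing S] {rs : List R}

lemma isPrime (h : IsPrimeChain rs) : (Ideal.ofList rs).IsPrime := by
  simpa using h.1 rs.length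

lemma isRegular (h : IsPrimeChain rs) : RingTheory.Sequence.IsRegular R rs := by
  refine ⟨⟨fun k hk => ?_⟩, ?_⟩
  · rw [isSMulRegular_quotient_iff_mem_of_smul_mem]
    intro x hx
    rw [smul_eq_mul, Ideal.mul_top, smul_eq_mul] at hx
    rw [smul_eq_mul, Ideal.mul_top]
    exact ((h.1 k).mem_or_mem hx).resolve_left (h.2 k hk)
  · rw [smul_eq_mul, Ideal.mul_top]
    exact h.isPrime.ne_top.symm

lemma map (h : IsPrimeChain rs) (φ : R ≃+* S) : IsPrimeChain (rs.map φ) := by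
  have key (k : ℕ) : Ideal.ofList ((rs.map φ).take k) = (Ideal.ofList (rs.take k)).map φ := by
    rw [← List.map_take]
    exact (Ideal.map_ofList (φ : R →+* S) _).symm
  refine ⟨fun k => ?_, fun k hk => ?_⟩
  · have := h.1 k
    rw [key]
    exact Ideal.map_isPrime_of_equiv φ
  · rw [key, List.getElem_map, Ideal.mem_map_of_equiv]
    rintro ⟨x, hx, hxk⟩
    exact h.2 k (by simpa using hk) (φ.injective hxk ▸ hx)

lemma le_height (h : IsPrimeChain rs) (k : ℕ) (hk : k ≤ rs.length) :
    (k : ℕ∞) ≤ (Ideal.ofList (rs.take k)).height := by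
  induction k with
  | zero => simp
  | succ k ih =>
    have := h.1 k
    have := h.1 (k + 1)
    have hmem : rs[k] ∈ Ideal.ofList (rs.take (k + 1)) :=
      Ideal.subset_span (List.mem_take_iff_getElem.mpr ⟨k, by omega, rfl⟩)
    have hlt : Ideal.ofList (rs.take k) < Ideal.ofList (rs.take (k + 1)) := by
      refine lt_of_le_of_ne (Ideal.span_mono fun x hx => ?_) fun he => h.2 k hk (he ▸ hmem)
      exact (List.take_subset_take_left rs k.le_succ) hx
    push_cast
    exact (add_le_add_left (ih (by omega)) 1).trans
      (Ideal.height_add_one_le_of_lt_of_isPrime hlt)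

lemma height_eq [IsNoetherianRing R] (h : IsPrimeChain rs) :
    (Ideal.ofList rs).height = rs.length := by
  classical
  have := h.isPrime
  apply le_antisymm
  · have hset : {x | x ∈ rs} = (rs.toFinset : Set R) := by ext; simp
    have hmin : Ideal.ofList rs ∈ (Ideal.span (rs.toFinset : Set R)).minimalPrimes := by
      rw [← hset, Ideal.minimalPrimes_eq_subsingleton_self]
      rfl
    exact (Ideal.height_le_card_of_mem_minimalPrimes_span_finset hmin).trans
      (by exact_mod_cast rs.toFinset_card_le)
  · simpa using h.le_height rs.length le_rfl

end IsPrimeChain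

section Variables

variable {σ A : Type*} [CommRing A] (a : A) (l : List σ)

open Classical in
/-- Reduction modulo `a` that also sets the variables in `l` to zero. -/
noncomputable def reduceVars : MvPolynomial σ A →+* MvPolynomial σ (A ⧸ Ideal.span {a}) :=
  eval₂Hom (C.comp (Ideal.Quotient.mk _)) fun s => if s ∈ l then 0 else X s

lemma ker_reduceVars : RingHom.ker (reduceVars a l) = Ideal.ofList (C a :: l.map X) := by
  set I : Ideal (MvPolynomial σ A) := Ideal.ofList (C a :: l.map X)
  apply le_antisymm
  · have hC : ∀ x ∈ Ideal.span {a}, ((Ideal.Quotient.mk I).comp C) x = 0 := by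
      intro x hx
      obtain ⟨y, rfl⟩ := Ideal.mem_span_singleton.mp hx
      rw [RingHom.comp_apply, Ideal.Quotient.eq_zero_iff_mem, C_mul]
      exact I.mul_mem_right _ (Ideal.subset_span (by simp))
    let g : MvPolynomial σ (A ⧸ Ideal.span {a}) →+* MvPolynomial σ A ⧸ I :=
      eval₂Hom (Ideal.Quotient.lift _ _ hC) fun s => Ideal.Quotient.mk I (X s)
    have hg : g.comp (reduceVars a l) = Ideal.Quotient.mk I := by
      refine ringHom_ext (fun x => by simp [g, reduceVars]) fun s => ?_
      by_cases hs : s ∈ l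
      · have : (X s : MvPolynomial σ A) ∈ I :=
          Ideal.subset_span (List.mem_cons_of_mem _ (List.mem_map_of_mem hs))
        simp [g, reduceVars, hs, Ideal.Quotient.eq_zero_iff_mem.mpr this]
      · simp [g, reduceVars, hs]
    intro x hx
    rw [← Ideal.Quotient.eq_zero_iff_mem, ← hg, RingHom.comp_apply, RingHom.mem_ker.mp hx, map_zero]
  · refine Ideal.span_le.mpr fun x hx => ?_
    rw [SetLike.mem_coe, RingHom.mem_ker]
    obtain rfl | hx := List.mem_cons.mp hx
    · simp [reduceVars]
    · obtain ⟨s, hs, rfl⟩ := List.mem_map.mp hx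
      simp [reduceVars, hs]

lemma isPrimeChain_C_cons_map_X [IsDomain A] {a : A} (ha : Prime a) {l : List σ} (hl : l.Nodup) :
    IsPrimeChain (C a :: l.map X : List (MvPolynomial σ A)) := by
  have := (Ideal.span_singleton_prime ha.ne_zero).mpr ha
  refine ⟨fun k => ?_, fun k hk => ?_⟩ <;> cases k with
  | zero => simp [Ideal.isPrime_bot, ha.ne_zero]
  | succ k =>
    rw [List.take_succ_cons, ← List.map_take, ← ker_reduceVars]
    first
    | exact RingHom.ker_isPrime _
    | have hk' : k < l.length := by simpa using hk
      have hmem : l[k] ∉ l.take k := fun hmem => by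
        obtain ⟨j, hj, hjk⟩ := List.mem_take_iff_getElem.mp hmem
        have := (hl.getElem_inj_iff).mp hjk
        omega
      simp [RingHom.mem_ker, reduceVars, hmem, X_ne_zero]

end Variables

section Substitution

variable (p : ℕ) [Fact p.Prime] (i : ℕ)

lemma eVar_val_add_one {n : ℕ} (s : Fin n) : eVar p n (s + 1) = X s := by
  simp [eVar, Nat.succ_le_of_lt s.2]

/-- The substitution `e_{p+j} ↦ e_j e_p - e_{p+j}`, fixing `e_1, …, e_p`. -/
noncomputable def twist :
    MvPolynomial (Fin (p + i)) (Zp p) →ₐ[Zp p] MvPolynomial (Fin (p + i)) (Zp p) :=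
  aeval fun s => if p ≤ s.val then
    eVar p (p + i) (s + 1 - p) * eVar p (p + i) p - X s else X s

variable {i}

lemma twist_eVar_of_le {j : ℕ} (hj : j ≤ p) : twist p i (eVar p (p + i) j) = eVar p (p + i) j := by
  unfold eVar
  split_ifs with h
  · simp [twist, show ¬ p ≤ j - 1 by omega]
  · simp

lemma twist_eVar_add {j : ℕ} (h1 : 1 ≤ j) (hj : j ≤ i) : twist p i (eVar p (p + i) (p + j)) =
    eVar p (p + i) j * eVar p (p + i) p - eVar p (p + i) (p + j) := by
  have h := eVar_val_add_one p (⟨p + j - 1, by omega⟩ : Fin (p + i))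
  rw [show p + j - 1 + 1 = p + j by omega] at h
  rw [h, twist, aeval_X, if_pos (show p ≤ p + j - 1 by omega),
    show p + j - 1 + 1 - p = j by omega]

lemma twist_comp_twist (hi : i ≤ p - 1) : (twist p i).comp (twist p i) = AlgHom.id _ _ := by
  refine algHom_ext fun s => ?_
  rw [AlgHom.comp_apply, AlgHom.id_apply, ← eVar_val_add_one]
  have hs := s.2
  by_cases h : p ≤ s.val
  · obtain ⟨j, hj⟩ : ∃ j, s.val + 1 = p + j := ⟨s.val + 1 - p, by omega⟩
    rw [hj, twist_eVar_add p (by omega) (by omega), map_sub, map_mul,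
      twist_eVar_of_le p le_rfl, twist_eVar_of_le p (by omega),
      twist_eVar_add p (by omega) (by omega), sub_sub_cancel]
  · rw [twist_eVar_of_le p (by omega), twist_eVar_of_le p (by omega)]

lemma prime_natCast_Zp : Prime (p : Zp p) := by
  have hp0 : (p : Zp p) ≠ 0 := by
    have := IsLocalization.injective (Zp p) (pIdeal p).primeCompl_le_nonZeroDivisors
    rw [← map_natCast (algebraMap ℤ (Zp p)), ne_eq, map_eq_zero_iff _ this]
    exact_mod_cast (Fact.out : p.Prime).ne_zero
  rw [← Ideal.span_singleton_prime hp0]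
  have h := Localization.AtPrime.map_eq_maximalIdeal (I := pIdeal p)
  rw [Ideal.map_span, Set.image_singleton, map_natCast] at h
  rw [h]
  infer_instance

end Substitution

/-- Let `p` be prime and `n = p + i` with `0 ≤ i ≤ p − 1`.  The elements
`p, e_1e_p − e_{p+1}, …, e_ie_p − e_{p+i}, e_{i+1}, …, e_{p−1}` form a regular sequence in
the polynomial ring `ℤ_(p)[e_1,…,e_n]` (the `e_j` being independent variables), and the
ideal they generate is prime of height `p`. -/
theorem regular_sequence_prime_height (p : ℕ) [Fact p.Prime] (i : ℕ) (hi : i ≤ p - 1)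
    (L : List (MvPolynomial (Fin (p + i)) (Zp p)))
    (hL : L = C ((p : ℕ) : Zp p) ::
        ((List.range' 1 i).map
          (fun j => eVar p (p + i) j * eVar p (p + i) p - eVar p (p + i) (p + j)) ++
         (List.range' (i + 1) (p - 1 - i)).map (eVar p (p + i)))) :
    RingTheory.Sequence.IsRegular (MvPolynomial (Fin (p + i)) (Zp p)) L ∧
    ∃ hP : (Ideal.span {x | x ∈ L}).IsPrime,
      Order.height
        (⟨Ideal.span {x | x ∈ L}, hP⟩ :
          PrimeSpectrum (MvPolynomial (Fin (p + i)) (Zp p))) = p := by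
  have hp : 1 ≤ p := (Fact.out : p.Prime).one_lt.le
  let idx (k : ℕ) : Fin (p + i) := ⟨(k - 1) % (p + i), Nat.mod_lt _ (by omega)⟩
  have hidx {k : ℕ} (h1 : 1 ≤ k) (hk : k ≤ p + i) : (idx k).val = k - 1 :=
    Nat.mod_eq_of_lt (by omega)
  have hX {k : ℕ} (h1 : 1 ≤ k) (hk : k ≤ p + i) : X (idx k) = eVar p (p + i) k := by
    rw [← eVar_val_add_one, hidx h1 hk, Nat.sub_add_cancel h1]
  let l : List ℕ := (List.range' 1 i).map (p + ·) ++ List.range' (i + 1) (p - 1 - i)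
  have hl : ∀ k ∈ l, 1 ≤ k ∧ k ≤ p + i := by
    intro k hk
    simp only [l, List.mem_append, List.mem_map, List.mem_range'_1] at hk
    rcases hk with ⟨j, hj, rfl⟩ | hk <;> omega
  have hnodup : l.Nodup := by
    refine List.Nodup.append (List.Nodup.map (add_right_injective p) List.nodup_range') List.nodup_range' ?_
    intro k hk hk'
    simp only [List.mem_map, List.mem_range'_1] at hk hk'
    obtain ⟨j, hj, rfl⟩ := hk
    omega
  have hnodup' : (l.map idx).Nodup := by
    refine hnodup.map_on fun x hx y hy hxy => ?_
    have := congrArg Fin.val hxy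
    rw [hidx (hl x hx).1 (hl x hx).2, hidx (hl y hy).1 (hl y hy).2] at this
    have := hl x hx
    have := hl y hy
    omega
  let φ : MvPolynomial (Fin (p + i)) (Zp p) ≃ₐ[Zp p] MvPolynomial (Fin (p + i)) (Zp p) :=
    AlgEquiv.ofAlgHom (twist p i) (twist p i) (twist_comp_twist p hi) (twist_comp_twist p hi)
  have hφ : L = (C ((p : ℕ) : Zp p) :: (l.map idx).map X).map φ.toRingEquiv := by
    rw [hL, List.map_cons]
    congr 1
    · exact (AlgHom.commutes (twist p i) _).symm
    · simp only [l, List.map_append, List.map_map]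
      congr 1 <;> refine List.map_congr_left fun j hj => ?_ <;> rw [List.mem_range'_1] at hj
      · change _ = twist p i (X (idx (p + j)))
        rw [hX (by omega) (by omega), twist_eVar_add p (by omega) (by omega)]
      · change _ = twist p i (X (idx j))
        rw [hX (by omega) (by omega), twist_eVar_of_le p (by omega)]
  have hchain : IsPrimeChain L :=
    hφ ▸ (isPrimeChain_C_cons_map_X (prime_natCast_Zp p) hnodup').map φ.toRingEquiv
  refine ⟨hchain.isRegular, hchain.isPrime, ?_⟩
  rw [← PrimeSpectrum.height_eq_orderHeight]
  refine hchain.height_eq.trans ?_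
  rw [hL]
  simp only [List.length_cons, List.length_append, List.length_map, List.length_range']
  congr 1
  omega
end

section
/- Let p be prime and n = p + i with 0 ≤ i ≤ p − 1. Let R = F_p[e_1,…,e_n] and let J̃_n = ⟨e_1e_p − e_{p+1}, …, e_ie_p − e_{p+i}, e_{i+1}, …, e_{p−1}⟩ ⊂ R. Then the cofixed space F_p[x_1,…,x_n]_{S_n} decomposes as a graded R-module as R/J̃_n ⊕ J̃_n. -/
open MvPolynomial

set_option synthInstance.maxHeartbeats 1000000
set_option maxHeartbeats 1000000

/-- The `j`-th elementary symmetric polynomial in `n` variables over `F_p`, as an element of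
the invariant ring `R = F_p[e_1,…,e_n]` (the subalgebra of symmetric polynomials). -/
noncomputable def eF (p : ℕ) [Fact p.Prime] (n : ℕ) (j : ℕ) :
    (symmetricSubalgebra (Fin n) (ZMod p)) :=
  ⟨esymm (Fin n) (ZMod p) j,
    (mem_symmetricSubalgebra _).mpr (esymm_isSymmetric (Fin n) (ZMod p) j)⟩

namespace Cofixed

open scoped Classical in
/-- For a group of prime order `p` acting on `X`, there is a weight on `X` whose sum over an orbit
is `0` or `1` modulo `p`, according to whether the orbit is a single point or not. -/
theorem exists_weight {p : ℕ} [Fact p.Prime] {H X : Type*} [Group H] [Fintype H] [MulAction H X]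
    (hH : Fintype.card H = p) :
    ∃ χ : X → ZMod p, ∀ x, ∑ h : H, χ (h⁻¹ • x) = if ∀ h : H, h • x = x then 0 else 1 := by
  let rep : X → X := fun x => (Quotient.mk (MulAction.orbitRel H X) x).out
  have rep_smul (h : H) (x : X) : rep (h • x) = rep x :=
    congrArg Quotient.out (Quotient.sound (MulAction.mem_orbit x h))
  refine ⟨fun x => if rep x = x then 1 else 0, fun x => ?_⟩
  split_ifs with hx
  · simp [hx, hH]
  have : Fact (Nat.card H).Prime := ⟨by rw [Nat.card_eq_fintype_card, hH]; exact Fact.out⟩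
  have hstab : MulAction.stabilizer H x = ⊥ :=
    (Subgroup.eq_bot_or_eq_top_of_prime_card _).resolve_right fun htop =>
      hx fun h => MulAction.mem_stabilizer_iff.mp (htop ▸ Subgroup.mem_top h)
  obtain ⟨g, hg⟩ : ∃ g : H, g • x = rep x := Quotient.mk_out (s := MulAction.orbitRel H X) x
  rw [Finset.sum_eq_single g⁻¹]
  · have : rep (rep x) = rep x := by rw [← hg, rep_smul, hg]
    simp only [inv_inv, hg, this, if_true]
  · intro h _ hne
    refine if_neg fun heq => hne ?_
    rw [rep_smul] at heq
    have : h * g ∈ MulAction.stabilizer H x := by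
      rw [MulAction.mem_stabilizer_iff, mul_smul, hg, heq, smul_inv_smul]
    rw [hstab, Subgroup.mem_bot] at this
    exact eq_inv_of_mul_eq_one_left this
  · simp

theorem sum_eq_sum_quotient {G M : Type*} [Group G] [Fintype G] [AddCommMonoid M] (H : Subgroup G)
    [Fintype H] [Fintype (G ⧸ H)] (F : G → M) :
    ∑ g, F g = ∑ q : G ⧸ H, ∑ h : H, F (q.out * h) := by
  rw [← Fintype.sum_prod_type']
  refine (Function.Bijective.sum_comp (e := fun x : (G ⧸ H) × H => x.1.out * (x.2 : G))
    ⟨?_, fun g => ?_⟩ F).symm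
  · rintro ⟨q, h⟩ ⟨q', h'⟩ heq
    have hq : q = q' := by
      simpa [QuotientGroup.mk_mul_of_mem] using
        congrArg (QuotientGroup.mk : G → G ⧸ H) heq
    subst hq
    simpa using heq
  · obtain ⟨h, hh⟩ := QuotientGroup.mk_out_eq_mul H g
    exact ⟨(g, h⁻¹), by simp [hh]⟩

section Permutations

variable {σ k : Type*} [CommRing k]

/-- The linear endomorphism multiplying the monomial with exponent `α` by `χ α`. -/
noncomputable def diag (χ : (σ →₀ ℕ) → k) : MvPolynomial σ k →ₗ[k] MvPolynomial σ k :=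
  (basisMonomials σ k).constr k fun α => monomial α (χ α)

@[simp] theorem diag_monomial (χ : (σ →₀ ℕ) → k) (α : σ →₀ ℕ) (a : k) :
    diag χ (monomial α a) = monomial α (χ α * a) := by
  have h : (monomial α a : MvPolynomial σ k) = a • basisMonomials σ k α := by
    simp [smul_monomial]
  rw [h, map_smul, diag, Module.Basis.constr_basis, smul_monomial, smul_eq_mul, mul_comm]

theorem coeff_diag (χ : (σ →₀ ℕ) → k) (α : σ →₀ ℕ) (f : MvPolynomial σ k) :
    coeff α (diag χ f) = χ α * coeff α f := by
  classical
  induction f using MvPolynomial.induction_on' with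
  | monomial β a =>
    rw [diag_monomial, coeff_monomial, coeff_monomial]
    split_ifs with h <;> simp [h]
  | add f g hf hg => simp only [map_add, coeff_add, hf, hg, mul_add]

theorem rename_mul_apply (g h : Equiv.Perm σ) (f : MvPolynomial σ k) :
    rename (⇑(g * h)) f = rename g (rename h f) := by
  rw [rename_rename]; rfl

variable (H : Subgroup (Equiv.Perm σ))

open scoped Classical in
/-- The projection onto the span of the monomials fixed by `H`. -/
noncomputable def fixedProj : MvPolynomial σ k →ₗ[k] MvPolynomial σ k :=
  diag fun α => if ∀ h ∈ H, α.mapDomain h = α then 1 else 0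

theorem rename_fixedProj {h : Equiv.Perm σ} (hh : h ∈ H) (f : MvPolynomial σ k) :
    rename h (fixedProj H f) = fixedProj H f := by
  induction f using MvPolynomial.induction_on' with
  | monomial α a =>
    rw [fixedProj, diag_monomial]
    split_ifs with hα
    · rw [rename_monomial, hα h hh]
    · simp
  | add f g hf hg => simp only [map_add, hf, hg]

theorem exists_sum_conj_eq {p : ℕ} [Fact p.Prime] [Fintype H] (hH : Fintype.card H = p) :
    ∃ E : MvPolynomial σ (ZMod p) →ₗ[ZMod p] MvPolynomial σ (ZMod p), ∀ f,
      ∑ h : H, rename (h : Equiv.Perm σ) (E (rename (⇑(h : Equiv.Perm σ)⁻¹) f)) =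
        f - fixedProj H f := by
  classical
  let _ : MulAction H (σ →₀ ℕ) :=
    { smul := fun h α => α.mapDomain (h : Equiv.Perm σ)
      one_smul := fun α => by
        change α.mapDomain id = α
        exact Finsupp.mapDomain_id
      mul_smul := fun g h α => by
        change α.mapDomain (⇑(g : Equiv.Perm σ) ∘ ⇑(h : Equiv.Perm σ)) =
          (α.mapDomain (h : Equiv.Perm σ)).mapDomain (g : Equiv.Perm σ)
        exact Finsupp.mapDomain_comp }
  obtain ⟨χ, hχ⟩ := exists_weight (p := p) (H := H) (X := σ →₀ ℕ) hH
  refine ⟨diag χ, fun f => ?_⟩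
  induction f using MvPolynomial.induction_on' with
  | monomial α a =>
    have key : ∀ h : H, rename (h : Equiv.Perm σ)
        (diag χ (rename (⇑(h : Equiv.Perm σ)⁻¹) (monomial α a))) =
          monomial α (χ (h⁻¹ • α) * a) := by
      intro h
      rw [rename_monomial, diag_monomial, rename_monomial]
      exact congrArg (fun β => monomial β (χ (h⁻¹ • α) * a)) (smul_inv_smul h α)
    rw [Finset.sum_congr rfl fun h _ => key h, ← map_sum, ← Finset.sum_mul, hχ, fixedProj,
      diag_monomial]
    have hiff : (∀ h : H, h • α = α) ↔ ∀ h ∈ H, α.mapDomain h = α :=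
      ⟨fun h g hg => h ⟨g, hg⟩, fun h g => h g g.2⟩
    by_cases hα : ∀ h ∈ H, α.mapDomain h = α
    · rw [if_pos (hiff.mpr hα), if_pos hα]; simp
    · rw [if_neg (mt hiff.mp hα), if_neg hα]; simp
  | add f g hf hg =>
    simp only [map_add, Finset.sum_add_distrib, hf, hg]
    abel

/-- The relative transfer of a polynomial invariant under `H` is symmetric. -/
theorem isSymmetric_sum_quotient [Fintype (Equiv.Perm σ ⧸ H)] {f : MvPolynomial σ k}
    (hf : ∀ h ∈ H, rename h f = f) :
    (∑ q : Equiv.Perm σ ⧸ H, rename q.out f).IsSymmetric := by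
  have key (g : Equiv.Perm σ) : rename (g : Equiv.Perm σ ⧸ H).out f = rename g f := by
    obtain ⟨h, hh⟩ := QuotientGroup.mk_out_eq_mul H g
    rw [hh, rename_mul_apply, hf h h.2]
  intro e
  rw [map_sum, ← Equiv.sum_comp (MulAction.toPerm e : Equiv.Perm (Equiv.Perm σ ⧸ H))
    fun q => rename (⇑q.out) f]
  refine Finset.sum_congr rfl fun q _ => ?_
  rw [← rename_mul_apply, ← key (e * q.out)]
  congr 3
  rw [← smul_eq_mul, ← MulAction.Quotient.smul_coe]
  simp

theorem card_nsmul_sub_sum_rename_mem {N : AddSubgroup (MvPolynomial σ k)}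
    (hN : ∀ f (g : Equiv.Perm σ), f - rename g f ∈ N)
    (f : MvPolynomial σ k) {ι : Type*} [Fintype ι] (g : ι → Equiv.Perm σ) :
    Fintype.card ι • f - ∑ j, rename (g j) f ∈ N := by
  rw [← Finset.card_univ, ← Finset.sum_const, ← Finset.sum_sub_distrib]
  exact sum_mem fun j _ => hN f (g j)

variable [Fintype σ] [DecidableEq σ]

/-- The transfer `f ↦ ∑ g • f` from polynomials to symmetric polynomials. -/
noncomputable def transfer (σ k : Type*) [CommRing k] [Fintype σ] [DecidableEq σ] :
    MvPolynomial σ k →ₗ[symmetricSubalgebra σ k] symmetricSubalgebra σ k where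
  toFun f := ⟨∑ g : Equiv.Perm σ, rename g f, (mem_symmetricSubalgebra _).mpr fun e => by
    rw [map_sum, ← Equiv.sum_comp (Equiv.mulLeft e) fun g => rename (⇑g) f]
    exact Finset.sum_congr rfl fun g _ => (rename_mul_apply e g f).symm⟩
  map_add' f g := by ext1; simp [Finset.sum_add_distrib]
  map_smul' r f := by
    ext1
    simp only [Subalgebra.smul_def, smul_eq_mul, map_mul, RingHom.id_apply,
      MulMemClass.coe_mul, Finset.mul_sum]
    exact Finset.sum_congr rfl fun g _ => by rw [(mem_symmetricSubalgebra _).mp r.2 g]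

theorem coe_transfer (f : MvPolynomial σ k) :
    (transfer σ k f : MvPolynomial σ k) = ∑ g : Equiv.Perm σ, rename g f := rfl

theorem transfer_rename (g : Equiv.Perm σ) (f : MvPolynomial σ k) :
    transfer σ k (rename g f) = transfer σ k f := by
  ext1
  rw [coe_transfer, coe_transfer, ← Equiv.sum_comp (Equiv.mulRight g) fun h => rename (⇑h) f]
  exact Finset.sum_congr rfl fun h _ => (rename_mul_apply h g f).symm

theorem transfer_one : transfer σ k 1 = ((Fintype.card σ).factorial : symmetricSubalgebra σ k) := by
  ext1
  simp [coe_transfer, Fintype.card_perm]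

theorem transfer_eq_sum_quotient [Fintype H] [Fintype (Equiv.Perm σ ⧸ H)] (f : MvPolynomial σ k) :
    (transfer σ k f : MvPolynomial σ k) = ∑ h : H, rename (h : Equiv.Perm σ)
      (∑ q : Equiv.Perm σ ⧸ H, rename (⇑q.out⁻¹) f) := by
  rw [coe_transfer, ← Equiv.sum_comp (Equiv.inv (Equiv.Perm σ)), sum_eq_sum_quotient H,
    Finset.sum_comm, ← Equiv.sum_comp (Equiv.inv H)]
  refine Finset.sum_congr rfl fun h _ => ?_
  rw [map_sum]
  refine Finset.sum_congr rfl fun q _ => ?_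
  rw [← rename_mul_apply]
  simp

variable {p : ℕ} [Fact p.Prime]

theorem mem_of_nsmul_mem {A : Type*} [AddCommGroup A] [Module (ZMod p) A] (S : AddSubgroup A)
    {m : ℕ} (hm : ¬ p ∣ m) {x : A} (hx : m • x ∈ S) : x ∈ S := by
  have hm' : (m : ZMod p) ≠ 0 := by rwa [Ne, ZMod.natCast_eq_zero_iff]
  have h : x = ((m : ZMod p)⁻¹).val • (m • x) := by
    rw [← Nat.cast_smul_eq_nsmul (ZMod p), ← Nat.cast_smul_eq_nsmul (ZMod p) m, smul_smul,
      ZMod.natCast_val, ZMod.cast_id, inv_mul_cancel₀ hm', one_smul]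
  rw [h]
  exact S.nsmul_mem hx _

/-- A symmetric polynomial without monomials fixed by `H` is a transfer. -/
theorem exists_transfer_eq [Fintype H] (hH : Fintype.card H = p)
    [Fintype (Equiv.Perm σ ⧸ H)] (hidx : ¬ p ∣ H.index)
    (r : symmetricSubalgebra σ (ZMod p)) (hr : fixedProj H (r : MvPolynomial σ (ZMod p)) = 0) :
    ∃ f, transfer σ (ZMod p) f = r := by
  obtain ⟨E, hE⟩ := exists_sum_conj_eq H hH
  refine mem_of_nsmul_mem (LinearMap.range (transfer σ (ZMod p))).toAddSubgroup hidx
    ⟨E r, ?_⟩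
  ext1
  have hsym (g : Equiv.Perm σ) : rename g (r : MvPolynomial σ (ZMod p)) = r :=
    (mem_symmetricSubalgebra _).mp r.2 g
  have h1 := hE r
  simp only [hsym, hr, sub_zero] at h1
  rw [coe_transfer, sum_eq_sum_quotient H]
  simp only [rename_mul_apply, ← map_sum, h1, hsym]
  simp [Subgroup.index_eq_card]

/-- Modulo `N`, a polynomial with zero transfer is congruent to a symmetric polynomial. -/
theorem exists_sub_mem_of_transfer_eq_zero [Fintype H] (hH : Fintype.card H = p)
    [Fintype (Equiv.Perm σ ⧸ H)] (hidx : ¬ p ∣ H.index)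
    {N : AddSubgroup (MvPolynomial σ (ZMod p))} (hN : ∀ f (g : Equiv.Perm σ), f - rename g f ∈ N)
    (f : MvPolynomial σ (ZMod p)) (hf : transfer σ (ZMod p) f = 0) :
    ∃ r : symmetricSubalgebra σ (ZMod p), f - (r : MvPolynomial σ (ZMod p)) ∈ N := by
  obtain ⟨E, hE⟩ := exists_sum_conj_eq H hH
  rw [Subgroup.index_eq_card, Nat.card_eq_fintype_card] at hidx
  set m := Fintype.card (Equiv.Perm σ ⧸ H)
  set g := ∑ q : Equiv.Perm σ ⧸ H, rename (⇑q.out⁻¹) f with hg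
  have hfg : m • f - g ∈ N := card_nsmul_sub_sum_rename_mem hN f _
  have hgE : g - fixedProj H g ∈ N := by
    have h0 : ∑ h : H, rename (⇑(h : Equiv.Perm σ)⁻¹) g = 0 := by
      have h1 := transfer_eq_sum_quotient H f
      rw [hf, ← hg, ← Equiv.sum_comp (Equiv.inv H)] at h1
      exact h1.symm
    rw [← hE, ← neg_mem_iff, ← zero_sub, ← map_zero E, ← h0, map_sum, ← Finset.sum_sub_distrib]
    exact sum_mem fun h _ => hN _ _
  have hs : m • fixedProj H g - ∑ q : Equiv.Perm σ ⧸ H, rename q.out (fixedProj H g) ∈ N :=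
    card_nsmul_sub_sum_rename_mem hN _ _
  obtain ⟨s, hs'⟩ : ∃ s : symmetricSubalgebra σ (ZMod p), (s : MvPolynomial σ (ZMod p)) =
      ∑ q : Equiv.Perm σ ⧸ H, rename q.out (fixedProj H g) :=
    ⟨⟨_, (mem_symmetricSubalgebra _).mpr
      (isSymmetric_sum_quotient H fun h hh => rename_fixedProj H hh g)⟩, rfl⟩
  rw [← hs'] at hs
  have hm : (m : ZMod p) ≠ 0 := by rwa [Ne, ZMod.natCast_eq_zero_iff]
  refine ⟨((m : ZMod p) ^ 2)⁻¹ • s, mem_of_nsmul_mem N hidx (mem_of_nsmul_mem N hidx ?_)⟩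
  have hcancel : m • m • (((m : ZMod p) ^ 2)⁻¹ • (s : MvPolynomial σ (ZMod p))) = s := by
    rw [← Nat.cast_smul_eq_nsmul (ZMod p), ← Nat.cast_smul_eq_nsmul (ZMod p), smul_smul,
      smul_smul, ← sq, mul_inv_cancel₀ (pow_ne_zero 2 hm), one_smul]
  have hdecomp : m • m • (f - (((m : ZMod p) ^ 2)⁻¹ • s : symmetricSubalgebra σ (ZMod p))) =
      m • (m • f - g) + m • (g - fixedProj H g) + (m • fixedProj H g - s) := by
    rw [Subalgebra.coe_smul, smul_sub, smul_sub, hcancel]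
    simp only [smul_sub]
    abel
  rw [hdecomp]
  exact N.add_mem (N.add_mem (N.nsmul_mem hfg m) (N.nsmul_mem hgE m)) hs

end Permutations

section Prime

theorem exists_factorial_eq_mul {p i : ℕ} [hp : Fact p.Prime] (hi : i < p) :
    ∃ m, (p + i).factorial = p * m ∧ ¬ p ∣ m := by
  induction i with
  | zero =>
    refine ⟨(p - 1).factorial, (Nat.mul_factorial_pred hp.out.ne_zero).symm, ?_⟩
    rw [hp.out.dvd_factorial]
    have := hp.out.pos
    omega
  | succ i ih =>
    obtain ⟨m, hm, hpm⟩ := ih (by omega)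
    refine ⟨(p + (i + 1)) * m, by rw [← add_assoc, Nat.factorial_succ, hm]; ring, ?_⟩
    rw [hp.out.dvd_mul, not_or]
    refine ⟨fun h => ?_, hpm⟩
    rw [Nat.dvd_add_right (dvd_refl p)] at h
    exact absurd (Nat.le_of_dvd (by omega) h) (by omega)

theorem exists_cyclic_subgroup (p i : ℕ) [NeZero p] :
    ∃ H : Subgroup (Equiv.Perm (Fin (p + i))), Nat.card H = p ∧
      (∀ h ∈ H, ∀ j : Fin i, h (Fin.natAdd p j) = Fin.natAdd p j) ∧
      (∀ h ∈ H, ∀ a : Fin p, ∃ b : Fin p, h (Fin.castAdd i a) = Fin.castAdd i b) ∧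
      ∀ a b : Fin p, ∃ h ∈ H, h (Fin.castAdd i a) = Fin.castAdd i b := by
  let φ : Multiplicative (Fin p) →* Equiv.Perm (Fin (p + i)) :=
    { toFun := fun a => finSumFinEquiv.permCongr
        (Equiv.sumCongr (Equiv.addLeft (Multiplicative.toAdd a)) 1)
      map_one' := by
        ext x
        induction x using Fin.addCases <;> simp
      map_mul' := fun a b => by
        ext x
        induction x using Fin.addCases <;> simp [add_assoc] }
  have hφl (a : Multiplicative (Fin p)) (b : Fin p) :
      φ a (Fin.castAdd i b) = Fin.castAdd i (Multiplicative.toAdd a + b) := by simp [φ]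
  have hφr (a : Multiplicative (Fin p)) (j : Fin i) :
      φ a (Fin.natAdd p j) = Fin.natAdd p j := by simp [φ]
  have hinj : Function.Injective φ := fun a b hab => by
    have := congrArg (fun e : Equiv.Perm (Fin (p + i)) => e (Fin.castAdd i 0)) hab
    simpa [hφl] using this
  refine ⟨φ.range, ?_, ?_, ?_, fun a b => ?_⟩
  · rw [← Nat.card_congr (MonoidHom.ofInjective hinj).toEquiv]
    simp
  · rintro _ ⟨a, rfl⟩ j
    exact hφr a j
  · rintro _ ⟨a, rfl⟩ b
    exact ⟨_, hφl a b⟩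
  · exact ⟨_, ⟨Multiplicative.ofAdd (b - a), rfl⟩, by rw [hφl]; simp⟩

end Prime

section Specialization

variable (p i : ℕ) (k : Type*) [CommRing k]

/-- The specialization of the first `p` variables to a single one, the variable of the outer
polynomial ring. -/
noncomputable def specialize :
    MvPolynomial (Fin (p + i)) k →ₐ[k] Polynomial (MvPolynomial (Fin i) k) :=
  aeval (Fin.addCases (fun _ => Polynomial.X) fun j => Polynomial.C (X j))

@[simp] theorem specialize_X_castAdd (a : Fin p) :
    specialize p i k (X (Fin.castAdd i a)) = Polynomial.X := by
  simp [specialize]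

@[simp] theorem specialize_X_natAdd (j : Fin i) :
    specialize p i k (X (Fin.natAdd p j)) = Polynomial.C (X j) := by
  simp [specialize]

theorem specialize_monomial (α : Fin (p + i) →₀ ℕ) (a : k) :
    specialize p i k (monomial α a) = Polynomial.monomial (∑ b : Fin p, α (Fin.castAdd i b))
      (monomial (α.comapDomain (Fin.natAdd p) (Fin.natAdd_injective i p).injOn) a) := by
  rw [specialize, aeval_monomial, Finsupp.prod_fintype _ _ (by simp), Fin.prod_univ_add]
  simp only [Fin.addCases_left, Fin.addCases_right, Finset.prod_pow_eq_pow_sum]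
  rw [monomial_eq, Finsupp.prod_fintype _ _ (by simp), ← Polynomial.C_mul_X_pow_eq_monomial]
  simp only [Finsupp.comapDomain_apply, map_mul, map_prod, map_pow]
  rw [IsScalarTower.algebraMap_apply k (MvPolynomial (Fin i) k)]
  simp only [Polynomial.algebraMap_eq, MvPolynomial.algebraMap_eq]
  ring

/-- The `l`-th variable, with `1` for `l = 0` and `0` for `l > i`. -/
noncomputable def var (l : ℕ) : MvPolynomial (Fin i) k :=
  if l = 0 then 1 else if h : l - 1 < i then X ⟨l - 1, h⟩ else 0

/-- The homomorphism through which the restriction of `specialize` to the symmetric polynomials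
factors in characteristic `p`. -/
noncomputable def factor :
    symmetricSubalgebra (Fin (p + i)) k →ₐ[k] Polynomial (MvPolynomial (Fin i) k) :=
  (aeval fun m : Fin (p + i) => Polynomial.C (var i k (m + 1)) +
    if p ≤ m + 1 then Polynomial.X * Polynomial.C (var i k (m + 1 - p)) else 0).comp
    (esymmAlgEquiv (Fin (p + i)) k (Fintype.card_fin _)).symm.toAlgHom

/-- The `m`-th elementary symmetric polynomial, as an element of the ring of symmetric
polynomials. -/
noncomputable def symmE (n m : ℕ) : symmetricSubalgebra (Fin n) k :=
  ⟨esymm (Fin n) k m, (mem_symmetricSubalgebra _).mpr (esymm_isSymmetric (Fin n) k m)⟩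

theorem factor_symmE (hp : 0 < p) {m : ℕ} (hm : m ≤ p + i) :
    factor p i k (symmE k (p + i) m) = Polynomial.C (var i k m) +
      if p ≤ m then Polynomial.X * Polynomial.C (var i k (m - p)) else 0 := by
  obtain _ | m := m
  · have h : symmE k (p + i) 0 = 1 := by ext1; simp [symmE]
    rw [h, map_one, if_neg (by omega), var, if_pos rfl, map_one, add_zero]
  · have h := esymmAlgEquiv_symm_apply (R := k) (Fintype.card_fin (p + i)) ⟨m, hm⟩
    have h' : (esymmAlgEquiv (Fin (p + i)) k (Fintype.card_fin _)).symm (symmE k (p + i) (m + 1)) =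
      X ⟨m, hm⟩ := h
    change aeval _ ((esymmAlgEquiv (Fin (p + i)) k (Fintype.card_fin _)).symm _) = _
    rw [h', aeval_X]

theorem symmetric_algHom_ext {n : ℕ} {k : Type*} [CommRing k] {A : Type*} [CommRing A]
    [Algebra k A] {f g : symmetricSubalgebra (Fin n) k →ₐ[k] A}
    (h : ∀ m, 1 ≤ m → m ≤ n → f (symmE k n m) = g (symmE k n m)) : f = g := by
  set e := esymmAlgEquiv (Fin n) k (Fintype.card_fin n) with he
  suffices f.comp e.toAlgHom = g.comp e.toAlgHom by
    ext1 x
    simpa using DFunLike.congr_fun this (e.symm x)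
  ext m
  have hm : e (X m) = symmE k n (m + 1) := by
    rw [← AlgEquiv.eq_symm_apply]
    exact (esymmAlgEquiv_symm_apply (R := k) (Fintype.card_fin n) m).symm
  simpa [hm] using h (m + 1) (by omega) (by omega)

/-- The homomorphism sending the variables to the elementary symmetric polynomials and the outer
variable to its `p`-th power. -/
noncomputable def expandEsymm :
    Polynomial (MvPolynomial (Fin i) k) →ₐ[k] Polynomial (MvPolynomial (Fin i) k) :=
  ((Polynomial.expand (MvPolynomial (Fin i) k) p).restrictScalars k).comp
    (Polynomial.mapAlgHom ((symmetricSubalgebra (Fin i) k).val.comp (esymmAlgHom (Fin i) k i)))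

theorem expandEsymm_injective (hp : 0 < p) : Function.Injective (expandEsymm p i k) := by
  refine (Polynomial.expand_injective hp).comp (Polynomial.map_injective _ ?_)
  exact Subtype.val_injective.comp (esymmAlgHom_fin_injective k le_rfl)

theorem esymm_eq_zero_of_lt {m : ℕ} (hm : i < m) : esymm (Fin i) k m = 0 := by
  rw [esymm, Finset.powersetCard_eq_empty.mpr (by simpa using hm), Finset.sum_empty]

theorem expandEsymm_C_var (l : ℕ) :
    expandEsymm p i k (Polynomial.C (var i k l)) = Polynomial.C (esymm (Fin i) k l) := by
  have h : esymmAlgHom (Fin i) k i (var i k l) = symmE k i l := by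
    rw [var]
    split_ifs with h0 h1
    · subst h0
      ext1
      simp [symmE]
    · rw [esymmAlgHom, aeval_X]
      ext1
      simp [symmE, Nat.sub_add_cancel (Nat.pos_of_ne_zero h0)]
    · ext1
      simp [symmE, esymm_eq_zero_of_lt i k (m := l) (by omega)]
  simp [expandEsymm, h, symmE]

@[simp] theorem expandEsymm_X : expandEsymm p i k Polynomial.X = Polynomial.X ^ p := by
  simp [expandEsymm]

theorem specialize_esymm [Fact p.Prime] [CharP k p] {m : ℕ} (hm : m ≤ p + i) :
    specialize p i k (esymm (Fin (p + i)) k m) = Polynomial.C (esymm (Fin i) k m) +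
      if p ≤ m then Polynomial.X ^ p * Polynomial.C (esymm (Fin i) k (m - p)) else 0 := by
  have : ExpChar k p := .prime Fact.out
  have h := prod_X_add_C_coeff k (Fin (p + i)) (p + i - m) (by simp)
  rw [Fintype.card_fin, Nat.sub_sub_self hm] at h
  rw [← h, ← AlgHom.coe_toRingHom, ← Polynomial.coeff_map, Polynomial.map_prod, Fin.prod_univ_add]
  simp only [Polynomial.map_add, Polynomial.map_X, Polynomial.map_C, AlgHom.coe_toRingHom,
    specialize_X_castAdd, specialize_X_natAdd, Finset.prod_const, Finset.card_univ,
    Fintype.card_fin]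
  rw [add_pow_char, ← Polynomial.C_pow]
  set Q : Polynomial (MvPolynomial (Fin i) k) := ∏ j, (Polynomial.X + Polynomial.C (X j)) with hQ
  have hQmap : ∏ j : Fin i, (Polynomial.X + Polynomial.C (Polynomial.C (X j))) =
      Q.map (Polynomial.C : _ →+* Polynomial (MvPolynomial (Fin i) k)) := by
    simp [hQ, Polynomial.map_prod]
  have hQcoeff (l : ℕ) (hl : l ≤ i) : Q.coeff (i - l) = esymm (Fin i) k l := by
    have := prod_X_add_C_coeff k (Fin i) (i - l) (by simp)
    rwa [Fintype.card_fin, Nat.sub_sub_self hl] at this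
  have hQdeg (l : ℕ) (hl : i < l) : Q.coeff l = 0 := by
    refine Polynomial.coeff_eq_zero_of_natDegree_lt (lt_of_le_of_lt ?_ hl)
    refine (Polynomial.natDegree_prod_le _ _).trans ((Finset.sum_le_sum fun j _ =>
      Polynomial.natDegree_add_C.trans_le Polynomial.natDegree_X_le).trans (by simp))
  rw [hQmap, add_mul, Polynomial.coeff_add, Polynomial.coeff_X_pow_mul', Polynomial.coeff_C_mul,
    Polynomial.coeff_map, Polynomial.coeff_map]
  congr 1
  · split_ifs with h1
    · rw [show p + i - m - p = i - m by omega, hQcoeff m (by omega)]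
    · rw [esymm_eq_zero_of_lt i k (by omega), map_zero]
  · split_ifs with h1
    · rw [show p + i - m = i - (m - p) by omega, hQcoeff _ (by omega)]
    · rw [hQdeg _ (by omega), map_zero, mul_zero]

theorem expandEsymm_factor [hp : Fact p.Prime] [CharP k p]
    (r : symmetricSubalgebra (Fin (p + i)) k) :
    expandEsymm p i k (factor p i k r) = specialize p i k r := by
  suffices (expandEsymm p i k).comp (factor p i k) =
      (specialize p i k).comp (symmetricSubalgebra _ k).val from DFunLike.congr_fun this r
  refine symmetric_algHom_ext fun m _ hm => ?_
  rw [AlgHom.comp_apply, AlgHom.comp_apply, factor_symmE p i k hp.out.pos hm, map_add]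
  refine Eq.trans ?_ (specialize_esymm p i k hm).symm
  rw [expandEsymm_C_var]
  split_ifs
  · rw [map_mul, expandEsymm_X, expandEsymm_C_var]
  · rw [map_zero]

end Specialization

section FixedMonomials

variable {p i : ℕ}

theorem fixedProj_eq_zero_of_specialize_eq_zero {k : Type*} [CommRing k] (hp : 0 < p)
    {H : Subgroup (Equiv.Perm (Fin (p + i)))}
    (htrans : ∀ a b : Fin p, ∃ h ∈ H, h (Fin.castAdd i a) = Fin.castAdd i b)
    (f : MvPolynomial (Fin (p + i)) k) (hf : specialize p i k (fixedProj H f) = 0) :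
    fixedProj H f = 0 := by
  classical
  have hconst {α : Fin (p + i) →₀ ℕ} (hα : ∀ h ∈ H, α.mapDomain h = α) (a b : Fin p) :
      α (Fin.castAdd i a) = α (Fin.castAdd i b) := by
    obtain ⟨h, hh, hab⟩ := htrans a b
    rw [← hab]
    conv_rhs => rw [← hα h hh]
    rw [Finsupp.mapDomain_apply h.injective]
  have key {α : Fin (p + i) →₀ ℕ} (hα : ∀ h ∈ H, α.mapDomain h = α)
      (g : MvPolynomial (Fin (p + i)) k) :
      coeff (α.comapDomain (Fin.natAdd p) (Fin.natAdd_injective i p).injOn)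
        ((specialize p i k (fixedProj H g)).coeff (∑ b : Fin p, α (Fin.castAdd i b))) =
          coeff α (fixedProj H g) := by
    induction g using MvPolynomial.induction_on' with
    | monomial β a =>
      rw [fixedProj, diag_monomial]
      split_ifs with hβ
      · rw [one_mul, specialize_monomial, Polynomial.coeff_monomial, coeff_monomial]
        by_cases hβα : β = α
        · simp [hβα]
        rw [if_neg hβα]
        split_ifs with hsum
        · rw [coeff_monomial, if_neg]
          intro hcomap
          apply hβα
          ext x
          induction x using Fin.addCases with
          | left x =>
            have h1 (y : Fin p) := hconst hα y x
            have h2 (y : Fin p) := hconst hβ y x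
            simp only [h1, h2, Finset.sum_const, Finset.card_univ, Fintype.card_fin,
              smul_eq_mul] at hsum
            exact Nat.eq_of_mul_eq_mul_left hp hsum
          | right x => simpa using DFunLike.congr_fun hcomap x
        · simp
      · simp
    | add g g' hg hg' => simp only [map_add, Polynomial.coeff_add, coeff_add, hg, hg']
  ext α
  by_cases hα : ∀ h ∈ H, α.mapDomain h = α
  · rw [← key hα, hf, Polynomial.coeff_zero, coeff_zero, coeff_zero]
  · rw [fixedProj, coeff_diag, if_neg hα, zero_mul, coeff_zero]

variable {k : Type*} [CommRing k] {H : Subgroup (Equiv.Perm (Fin (p + i)))}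

theorem specialize_rename
    (hr : ∀ h ∈ H, ∀ j : Fin i, h (Fin.natAdd p j) = Fin.natAdd p j)
    (hl : ∀ h ∈ H, ∀ a : Fin p, ∃ b : Fin p, h (Fin.castAdd i a) = Fin.castAdd i b)
    {h : Equiv.Perm (Fin (p + i))} (hh : h ∈ H)
    (f : MvPolynomial (Fin (p + i)) k) :
    specialize p i k (rename h f) = specialize p i k f := by
  suffices (specialize p i k).comp (rename h) = specialize p i k from DFunLike.congr_fun this f
  ext1 x
  induction x using Fin.addCases with
  | left a =>
    obtain ⟨b, hb⟩ := hl h hh a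
    simp [hb]
  | right j => simp [hr h hh j]

theorem specialize_sum_rename [Fintype H] [CharP k p]
    (hr : ∀ h ∈ H, ∀ j : Fin i, h (Fin.natAdd p j) = Fin.natAdd p j)
    (hl : ∀ h ∈ H, ∀ a : Fin p, ∃ b : Fin p, h (Fin.castAdd i a) = Fin.castAdd i b)
    (hH : Fintype.card H = p)
    (f : MvPolynomial (Fin (p + i)) k) :
    specialize p i k (∑ h : H, rename (h : Equiv.Perm (Fin (p + i))) f) = 0 := by
  rw [map_sum, Finset.sum_congr rfl fun h _ => specialize_rename hr hl h.2 f, Finset.sum_const,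
    Finset.card_univ, hH, ← Nat.cast_smul_eq_nsmul k, CharP.cast_eq_zero, zero_smul]

end FixedMonomials

section Transfer

variable {p i : ℕ} [hp : Fact p.Prime]

theorem factor_transfer {k : Type*} [CommRing k] [CharP k p]
    (f : MvPolynomial (Fin (p + i)) k) : factor p i k (transfer _ k f) = 0 := by
  classical
  obtain ⟨H, hH, hr, hl, -⟩ := exists_cyclic_subgroup p i
  apply expandEsymm_injective p i k hp.out.pos
  rw [expandEsymm_factor, map_zero, transfer_eq_sum_quotient H,
    specialize_sum_rename hr hl (by rw [← Nat.card_eq_fintype_card, hH])]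

theorem not_dvd_index {H : Subgroup (Equiv.Perm (Fin (p + i)))} (hH : Nat.card H = p)
    (hi : i < p) : ¬ p ∣ H.index := by
  obtain ⟨m, hm, hpm⟩ := exists_factorial_eq_mul hi
  have h := H.card_mul_index
  rw [hH, Nat.card_eq_fintype_card, Fintype.card_perm, Fintype.card_fin, hm] at h
  rwa [Nat.eq_of_mul_eq_mul_left hp.out.pos h]

theorem exists_transfer_eq_of_factor_eq_zero (hi : i < p)
    (r : symmetricSubalgebra (Fin (p + i)) (ZMod p)) (hr : factor p i (ZMod p) r = 0) :
    ∃ f, transfer _ (ZMod p) f = r := by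
  classical
  obtain ⟨H, hH, hHr, hHl, htrans⟩ := exists_cyclic_subgroup p i
  have hH' : Fintype.card H = p := by rw [← Nat.card_eq_fintype_card, hH]
  refine exists_transfer_eq H hH' (not_dvd_index hH hi) r
    (fixedProj_eq_zero_of_specialize_eq_zero hp.out.pos htrans _ ?_)
  have h0 : specialize p i (ZMod p) r = 0 := by rw [← expandEsymm_factor, hr, map_zero]
  obtain ⟨E, hE⟩ := exists_sum_conj_eq H hH'
  have h1 := congrArg (specialize p i (ZMod p)) (hE r)
  simp only [(mem_symmetricSubalgebra _).mp r.2 _] at h1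
  rwa [specialize_sum_rename hHr hHl hH', map_sub, h0, zero_sub, zero_eq_neg] at h1

theorem exists_sub_mem (hi : i < p) {N : AddSubgroup (MvPolynomial (Fin (p + i)) (ZMod p))}
    (hN : ∀ f (g : Equiv.Perm (Fin (p + i))), f - rename g f ∈ N)
    (f : MvPolynomial (Fin (p + i)) (ZMod p)) (hf : transfer _ (ZMod p) f = 0) :
    ∃ r : symmetricSubalgebra (Fin (p + i)) (ZMod p),
      f - (r : MvPolynomial (Fin (p + i)) (ZMod p)) ∈ N := by
  classical
  obtain ⟨H, hH, -⟩ := exists_cyclic_subgroup p i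
  exact exists_sub_mem_of_transfer_eq_zero H (by rw [← Nat.card_eq_fintype_card, hH])
    (not_dvd_index hH hi) hN f hf

end Transfer

section Functional

theorem factor_map {p i : ℕ} (hp : 0 < p) {k k' : Type*} [CommRing k] [CommRing k']
    (φ : k →+* k') (r : symmetricSubalgebra (Fin (p + i)) k)
    (r' : symmetricSubalgebra (Fin (p + i)) k')
    (h : (r' : MvPolynomial (Fin (p + i)) k') = map φ (r : MvPolynomial (Fin (p + i)) k)) :
    factor p i k' r' = (factor p i k r).map (map φ) := by
  have hvar (l : ℕ) : map φ (var i k l) = var i k' l := by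
    rw [var, var]
    split_ifs <;> simp
  let ψ : symmetricSubalgebra (Fin (p + i)) k →+* symmetricSubalgebra (Fin (p + i)) k' :=
    ((map φ).comp (symmetricSubalgebra (Fin (p + i)) k).val.toRingHom).codRestrict _ fun r =>
      (mem_symmetricSubalgebra _).mpr (((mem_symmetricSubalgebra _).mp r.2).map φ)
  have hψ (m : ℕ) : ψ (symmE k (p + i) m) = symmE k' (p + i) m := by
    ext1
    exact map_esymm _ _ _ _
  have hr' : r' = ψ r := by ext1; exact h
  subst hr'
  obtain ⟨P, rfl⟩ := (esymmAlgEquiv (Fin (p + i)) k (Fintype.card_fin _)).surjective r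
  induction P using MvPolynomial.induction_on with
  | C a =>
    have h1 : esymmAlgEquiv (Fin (p + i)) k (Fintype.card_fin _) (C a) = algebraMap _ _ a :=
      AlgEquiv.commutes _ a
    have h2 : ψ (algebraMap _ _ a) = algebraMap k' _ (φ a) := by
      ext1
      exact map_C φ a
    rw [h1, h2, AlgHom.commutes, AlgHom.commutes, Polynomial.algebraMap_apply,
      Polynomial.algebraMap_apply, Polynomial.map_C, MvPolynomial.algebraMap_eq,
      MvPolynomial.algebraMap_eq, map_C]
  | add P Q hP hQ =>
    simp only [map_add, Polynomial.map_add]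
    rw [hP (by rfl), hQ (by rfl)]
  | mul_X P m hP =>
    have hm : esymmAlgEquiv (Fin (p + i)) k (Fintype.card_fin _) (X m) =
        symmE k (p + i) (m + 1) := by
      rw [← AlgEquiv.eq_symm_apply]
      exact (esymmAlgEquiv_symm_apply (R := k) (Fintype.card_fin (p + i)) m).symm
    simp only [map_mul, Polynomial.map_mul]
    rw [hP (by rfl), hm, hψ, factor_symmE p i k hp (by omega), factor_symmE p i k' hp (by omega)]
    congr 1
    split_ifs <;> simp [hvar]

variable {p i : ℕ} [hp : Fact p.Prime]

theorem natCast_dvd_of_map_eq_zero {σ : Type*} {n : ℕ} (f : Polynomial (MvPolynomial σ ℤ))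
    (hf : f.map (map (Int.castRingHom (ZMod n))) = 0) :
    (n : Polynomial (MvPolynomial σ ℤ)) ∣ f := by
  have h : (n : Polynomial (MvPolynomial σ ℤ)) = Polynomial.C (C (n : ℤ)) := by simp
  rw [h, Polynomial.C_dvd_iff_dvd_coeff]
  intro l
  rw [MvPolynomial.C_dvd_iff_zmod, ← Polynomial.coeff_map, hf, Polynomial.coeff_zero]

theorem coe_transfer_map {σ k k' : Type*} [Fintype σ] [DecidableEq σ] [CommRing k] [CommRing k']
    (φ : k →+* k') (f : MvPolynomial σ k) :
    (transfer σ k' (map φ f) : MvPolynomial σ k') = map φ (transfer σ k f) := by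
  simp [coe_transfer, map_rename]

/-- Dividing an integral lift of the transfer by `p` gives an invariant functional which is
semilinear over the symmetric polynomials and a unit at `1`. -/
theorem exists_functional (hi : i < p) :
    ∃ ψ : MvPolynomial (Fin (p + i)) (ZMod p) → Polynomial (MvPolynomial (Fin i) (ZMod p)),
      (∀ f g, ψ (f + g) = ψ f + ψ g) ∧
      (∀ (r : symmetricSubalgebra (Fin (p + i)) (ZMod p)) f,
        ψ (r * f) = factor p i (ZMod p) r * ψ f) ∧
      (∀ (g : Equiv.Perm (Fin (p + i))) f, ψ (rename g f) = ψ f) ∧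
      ∃ u : ℕ, ¬ p ∣ u ∧ ψ 1 = u := by
  set red := Int.castRingHom (ZMod p)
  have hred : Function.Surjective
      (map red : MvPolynomial (Fin (p + i)) ℤ →+* MvPolynomial (Fin (p + i)) (ZMod p)) :=
    map_surjective red ZMod.intCast_surjective
  have hdvd (F : MvPolynomial (Fin (p + i)) ℤ) :
      ∃ G, factor p i ℤ (transfer _ ℤ F) = p * G := by
    refine natCast_dvd_of_map_eq_zero _ ?_
    rw [← factor_map hp.out.pos red _ (transfer _ (ZMod p) (map red F)) (coe_transfer_map red F),
      factor_transfer]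
  choose ψ₀ hψ₀ using hdvd
  have hp0 : (p : Polynomial (MvPolynomial (Fin i) ℤ)) ≠ 0 := by
    exact_mod_cast hp.out.ne_zero
  have huniq {F G} (h : factor p i ℤ (transfer _ ℤ F) = p * G) : ψ₀ F = G :=
    mul_left_cancel₀ hp0 ((hψ₀ F).symm.trans h)
  have hadd (F G) : ψ₀ (F + G) = ψ₀ F + ψ₀ G :=
    huniq (by rw [map_add, map_add, hψ₀, hψ₀, mul_add])
  have hmul (r : symmetricSubalgebra (Fin (p + i)) ℤ) (F) :
      ψ₀ (r * F) = factor p i ℤ r * ψ₀ F := by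
    refine huniq ?_
    have h : (r : MvPolynomial (Fin (p + i)) ℤ) * F = r • F := rfl
    rw [h, map_smul, smul_eq_mul, map_mul, hψ₀]
    ring
  have hcongr {F G} (h : map red F = map red G) :
      (ψ₀ F).map (map red) = (ψ₀ G).map (map red) := by
    obtain ⟨D, hD⟩ := (MvPolynomial.C_dvd_iff_zmod p (F - G)).mpr (by rw [map_sub, h, sub_self])
    have hFG : F = G + ((p : symmetricSubalgebra (Fin (p + i)) ℤ) :
        MvPolynomial (Fin (p + i)) ℤ) * D := by
      have : ((p : symmetricSubalgebra (Fin (p + i)) ℤ) :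
        MvPolynomial (Fin (p + i)) ℤ) = C (p : ℤ) := by simp
      rw [this, ← hD]
      ring
    rw [hFG, hadd, hmul, map_natCast]
    simp
  obtain ⟨u, hu, hpu⟩ := exists_factorial_eq_mul hi
  refine ⟨fun f => (ψ₀ (Function.surjInv hred f)).map (map red), fun f g => ?_, fun r f => ?_,
    fun g f => ?_, u, hpu, ?_⟩
  · rw [← Polynomial.map_add, ← hadd]
    apply hcongr
    simp only [map_add, Function.surjInv_eq hred]
  · obtain ⟨P, hP⟩ := (esymmAlgEquiv (Fin (p + i)) (ZMod p) (Fintype.card_fin _)).surjective r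
    obtain ⟨s, hs⟩ : ∃ s : symmetricSubalgebra (Fin (p + i)) ℤ,
        (r : MvPolynomial (Fin (p + i)) (ZMod p)) = map red s := by
      obtain ⟨P', rfl⟩ := map_surjective red ZMod.intCast_surjective P
      refine ⟨esymmAlgEquiv (Fin (p + i)) ℤ (Fintype.card_fin _) P', ?_⟩
      rw [← hP]
      change (esymmAlgHom _ _ _ _).val = map red (esymmAlgHom _ _ _ _).val
      rw [esymmAlgHom_apply, esymmAlgHom_apply, map_aeval, aeval_def, eval₂_map]
      simp only [map_esymm]
      rw [coe_eval₂Hom]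
      congr 1
      exact RingHom.ext_int _ _
    rw [factor_map hp.out.pos red s r hs, ← Polynomial.map_mul, ← hmul]
    apply hcongr
    simp only [map_mul, Function.surjInv_eq hred, hs]
  · have h : ψ₀ (rename g (Function.surjInv hred f)) = ψ₀ (Function.surjInv hred f) :=
      huniq (by rw [transfer_rename, hψ₀])
    beta_reduce
    rw [← h]
    apply hcongr
    rw [map_rename, Function.surjInv_eq hred, Function.surjInv_eq hred]
  · have h : ψ₀ 1 = u := by
      refine huniq ?_
      rw [transfer_one, Fintype.card_fin, hu, map_natCast]
      push_cast
      rfl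
    have h' := hcongr (F := Function.surjInv hred 1) (G := 1)
      (by rw [Function.surjInv_eq hred, map_one])
    exact h'.trans (by rw [h, Polynomial.map_natCast])

end Functional

section Decomposition

variable {p i : ℕ}

/-- The homomorphism sending the variables to the elementary symmetric polynomials `e₁, …, eᵢ` and
the outer variable to `eₚ`. -/
noncomputable def lift (p i : ℕ) (k : Type*) [CommRing k] :
    Polynomial (MvPolynomial (Fin i) k) →ₐ[k] symmetricSubalgebra (Fin (p + i)) k :=
  Polynomial.eval₂AlgHom (aeval fun j : Fin i => symmE k (p + i) (j + 1)) (symmE k (p + i) p)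
    fun _ => Commute.all _ _

theorem lift_C_var {k : Type*} [CommRing k] {l : ℕ} :
    lift p i k (Polynomial.C (var i k l)) = if l ≤ i then symmE k (p + i) l else 0 := by
  simp only [lift, Polynomial.eval₂AlgHom_apply, Polynomial.eval₂_C, var]
  split_ifs with h0 h1 h2 h3
  · subst h0
    ext1
    simp [symmE]
  · omega
  · simp [Nat.sub_add_cancel (Nat.pos_of_ne_zero h0)]
  · omega
  · omega
  · simp

theorem lift_X {k : Type*} [CommRing k] : lift p i k Polynomial.X = symmE k (p + i) p := by
  simp [lift]

/-- The ideal `⟨e₁eₚ - eₚ₊₁, …, eᵢeₚ - eₚ₊ᵢ, eᵢ₊₁, …, eₚ₋₁⟩`. -/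
noncomputable def relIdeal (p i : ℕ) [Fact p.Prime] :
    Ideal (symmetricSubalgebra (Fin (p + i)) (ZMod p)) :=
  Ideal.span (((fun j => eF p (p + i) j * eF p (p + i) p - eF p (p + i) (p + j)) '' Set.Icc 1 i) ∪
    ((fun j => eF p (p + i) j) '' Set.Icc (i + 1) (p - 1)))

variable [hp : Fact p.Prime]

theorem factor_eq_zero_of_mem (hi : i < p) {r : symmetricSubalgebra (Fin (p + i)) (ZMod p)}
    (hr : r ∈ relIdeal p i) : factor p i (ZMod p) r = 0 := by
  have hF {m : ℕ} (hm : m ≤ p + i) := factor_symmE p i (ZMod p) hp.out.pos hm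
  have hvar {l : ℕ} (hl : i < l) : var i (ZMod p) l = 0 := by
    rw [var, if_neg (by omega), dif_neg (by omega)]
  suffices relIdeal p i ≤ RingHom.ker (factor p i (ZMod p)) from this hr
  rw [relIdeal, Ideal.span_le]
  rintro _ (⟨j, ⟨hj1, hj2⟩, rfl⟩ | ⟨j, ⟨hj1, hj2⟩, rfl⟩)
  · change factor p i (ZMod p) (symmE _ _ j * symmE _ _ p - symmE _ _ (p + j)) = 0
    rw [map_sub, map_mul, hF (by omega), hF (by omega), hF (by omega), if_neg (by omega),
      if_pos le_rfl, if_pos (by omega), hvar (l := p) hi, hvar (l := p + j) (by omega),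
      Nat.add_sub_cancel_left, Nat.sub_self]
    have h0 : var i (ZMod p) 0 = 1 := if_pos rfl
    rw [h0]
    simp only [map_zero, map_one]
    ring
  · change factor p i (ZMod p) (symmE _ _ j) = 0
    rw [hF (by omega), if_neg (by omega), hvar (by omega)]
    simp

theorem mk_lift_factor (hi : i < p) (r : symmetricSubalgebra (Fin (p + i)) (ZMod p)) :
    Ideal.Quotient.mk (relIdeal p i) (lift p i (ZMod p) (factor p i (ZMod p) r)) =
      Ideal.Quotient.mk (relIdeal p i) r := by
  let π : symmetricSubalgebra (Fin (p + i)) (ZMod p) →ₐ[ZMod p]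
      symmetricSubalgebra (Fin (p + i)) (ZMod p) ⧸ relIdeal p i :=
    Ideal.Quotient.mkₐ (ZMod p) (relIdeal p i)
  suffices (π.comp (lift p i (ZMod p))).comp (factor p i (ZMod p)) = π from
    DFunLike.congr_fun this r
  refine symmetric_algHom_ext (k := ZMod p)
    (A := symmetricSubalgebra (Fin (p + i)) (ZMod p) ⧸ relIdeal p i) fun m hm1 hm2 => ?_
  change Ideal.Quotient.mk (relIdeal p i)
      (lift p i (ZMod p) (factor p i (ZMod p) (symmE (ZMod p) (p + i) m))) =
    Ideal.Quotient.mk (relIdeal p i) (symmE (ZMod p) (p + i) m)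
  rw [factor_symmE p i _ hp.out.pos hm2, map_add, lift_C_var]
  by_cases hmi : m ≤ i
  · rw [if_pos hmi, if_neg (by omega), map_zero, add_zero]
  rw [if_neg hmi, zero_add]
  split_ifs with hpm
  · rw [map_mul, lift_X, lift_C_var, if_pos (by omega)]
    obtain ⟨j, rfl⟩ := Nat.exists_eq_add_of_le hpm
    rw [Nat.add_sub_cancel_left]
    obtain rfl | hj := Nat.eq_zero_or_pos j
    · have : symmE (ZMod p) (p + i) 0 = 1 := by ext1; simp [symmE]
      rw [this, mul_one, add_zero]
    · rw [mul_comm, Ideal.Quotient.eq]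
      exact Ideal.subset_span (Or.inl ⟨j, ⟨hj, by omega⟩, rfl⟩)
  · rw [map_zero, eq_comm, map_zero, Ideal.Quotient.eq_zero_iff_mem]
    exact Ideal.subset_span (Or.inr ⟨m, ⟨by omega, by omega⟩, rfl⟩)

theorem transfer_mem_relIdeal (hi : i < p) (f : MvPolynomial (Fin (p + i)) (ZMod p)) :
    transfer _ (ZMod p) f ∈ relIdeal p i := by
  rw [← Ideal.Quotient.eq_zero_iff_mem, ← mk_lift_factor hi, factor_transfer, map_zero, map_zero]

theorem exists_retraction (hi : i < p) :
    ∃ ψ : MvPolynomial (Fin (p + i)) (ZMod p) →ₗ[symmetricSubalgebra (Fin (p + i)) (ZMod p)]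
        symmetricSubalgebra (Fin (p + i)) (ZMod p) ⧸ relIdeal p i,
      (∀ (g : Equiv.Perm (Fin (p + i))) f, ψ (rename g f) = ψ f) ∧
      ∀ r : symmetricSubalgebra (Fin (p + i)) (ZMod p), ψ r = Ideal.Quotient.mk _ r := by
  obtain ⟨ψ, hadd, hmul, hinv, u, hpu, hu⟩ := exists_functional hi
  let v : symmetricSubalgebra (Fin (p + i)) (ZMod p) := algebraMap (ZMod p) _ (u : ZMod p)⁻¹
  have huv : v * u = 1 := by
    have hu' : (u : ZMod p) ≠ 0 := by rwa [Ne, ZMod.natCast_eq_zero_iff]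
    rw [← map_natCast (algebraMap (ZMod p) _), ← map_mul, inv_mul_cancel₀ hu', map_one]
  have hsmul (r : symmetricSubalgebra (Fin (p + i)) (ZMod p)) (f) :
      Ideal.Quotient.mk (relIdeal p i) (v * lift p i (ZMod p) (ψ (r * f))) =
        Ideal.Quotient.mk _ r * Ideal.Quotient.mk _ (v * lift p i (ZMod p) (ψ f)) := by
    rw [hmul, map_mul, map_mul, map_mul, mk_lift_factor hi, map_mul]
    ring
  refine ⟨{ toFun := fun f => Ideal.Quotient.mk _ (v * lift p i (ZMod p) (ψ f)),
            map_add' := fun f g => by rw [hadd, map_add, mul_add, map_add],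
            map_smul' := fun r f => hsmul r f }, fun g f => ?_, fun r => ?_⟩
  · change Ideal.Quotient.mk _ (v * lift p i (ZMod p) (ψ (rename g f))) = _
    rw [hinv]
    rfl
  · have h := hsmul r 1
    rw [hu, mul_one, map_natCast, huv, map_one, mul_one] at h
    exact h

/-- The projections of the cofixed space to the two summands, on representatives. -/
theorem exists_surjective_ker_eq (hi : i < p)
    {N : Submodule (symmetricSubalgebra (Fin (p + i)) (ZMod p))
      (MvPolynomial (Fin (p + i)) (ZMod p))}
    (hN : N = Submodule.span _ {x : MvPolynomial (Fin (p + i)) (ZMod p) |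
      ∃ (f : MvPolynomial (Fin (p + i)) (ZMod p)) (σ : Equiv.Perm (Fin (p + i))),
        x = f - rename (⇑σ) f}) :
    ∃ Φ : MvPolynomial (Fin (p + i)) (ZMod p) →ₗ[symmetricSubalgebra (Fin (p + i)) (ZMod p)]
        (symmetricSubalgebra (Fin (p + i)) (ZMod p) ⧸ relIdeal p i) × relIdeal p i,
      Function.Surjective Φ ∧ N = LinearMap.ker Φ := by
  obtain ⟨ψ, hinv, hψ⟩ := exists_retraction hi
  let T := (transfer (Fin (p + i)) (ZMod p)).codRestrict (relIdeal p i) (transfer_mem_relIdeal hi)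
  have hT (f) : (T f : symmetricSubalgebra (Fin (p + i)) (ZMod p)) = transfer _ _ f := rfl
  have hcard : (((p + i).factorial : ℕ) : ZMod p) = 0 := by
    rw [ZMod.natCast_eq_zero_iff, hp.out.dvd_factorial]
    omega
  have hTsymm (r : symmetricSubalgebra (Fin (p + i)) (ZMod p)) :
      transfer _ (ZMod p) (r : MvPolynomial (Fin (p + i)) (ZMod p)) = 0 := by
    have h : (r : MvPolynomial (Fin (p + i)) (ZMod p)) = r • 1 := (mul_one _).symm
    rw [h, map_smul, transfer_one, Fintype.card_fin, ← map_natCast (algebraMap (ZMod p) _), hcard,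
      map_zero, smul_zero]
  have hmem (f) (g : Equiv.Perm (Fin (p + i))) : f - rename g f ∈ N :=
    hN ▸ Submodule.subset_span ⟨f, g, rfl⟩
  have hker : N ≤ LinearMap.ker (ψ.prod T) := by
    rw [hN, Submodule.span_le]
    rintro _ ⟨f, g, rfl⟩
    have h1 : ψ (f - rename g f) = 0 := by rw [map_sub, hinv, sub_self]
    have h2 : T (f - rename g f) = 0 := by
      ext1
      rw [hT, map_sub, transfer_rename, sub_self]
      rfl
    exact Prod.ext h1 h2
  refine ⟨ψ.prod T, fun ⟨a, t⟩ => ?_, le_antisymm hker fun f hf => ?_⟩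
  · obtain ⟨f, hf⟩ := exists_transfer_eq_of_factor_eq_zero hi t (factor_eq_zero_of_mem hi t.2)
    obtain ⟨s, hs⟩ := Ideal.Quotient.mk_surjective (a - ψ f)
    refine ⟨f + s, Prod.ext ?_ ?_⟩
    · change ψ (f + s) = a
      rw [map_add, hψ, hs, add_sub_cancel]
    · refine Subtype.ext ?_
      change transfer (Fin (p + i)) (ZMod p) (f + (s : MvPolynomial (Fin (p + i)) (ZMod p))) =
        (t : symmetricSubalgebra (Fin (p + i)) (ZMod p))
      rw [map_add, hf, hTsymm, add_zero]
  · have hψf : ψ f = 0 := congrArg Prod.fst hf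
    have hTf : transfer _ _ f = 0 := congrArg Subtype.val (congrArg Prod.snd hf)
    obtain ⟨r, hr⟩ := exists_sub_mem hi (N := N.toAddSubgroup) hmem f hTf
    have hψr : Ideal.Quotient.mk (relIdeal p i) r = 0 := by
      have h : ψ (f - r) = 0 := congrArg Prod.fst (hker hr)
      rwa [map_sub, hψf, zero_sub, neg_eq_zero, hψ] at h
    rw [Ideal.Quotient.eq_zero_iff_mem] at hψr
    obtain ⟨g, hg⟩ := exists_transfer_eq_of_factor_eq_zero hi r (factor_eq_zero_of_mem hi hψr)
    have hgN := card_nsmul_sub_sum_rename_mem (N := N.toAddSubgroup) hmem g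
      (fun e : Equiv.Perm (Fin (p + i)) => e)
    rw [← coe_transfer, hg, Fintype.card_perm, Fintype.card_fin, ← Nat.cast_smul_eq_nsmul (ZMod p),
      hcard, zero_smul, zero_sub, neg_mem_iff] at hgN
    have := N.add_mem hr hgN
    rwa [sub_add_cancel] at this

theorem nonempty_quotient_equiv {R M P : Type*} [Ring R] [AddCommGroup M] [AddCommGroup P]
    [Module R M] [Module R P] {N : Submodule R M}
    (h : ∃ Φ : M →ₗ[R] P, Function.Surjective Φ ∧ N = LinearMap.ker Φ) :
    Nonempty ((M ⧸ N) ≃ₗ[R] P) := by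
  obtain ⟨Φ, hΦ, rfl⟩ := h
  exact ⟨Φ.quotKerEquivOfSurjective hΦ⟩

end Decomposition

end Cofixed

/-- Let `p` be prime and `n = p + i` with `0 ≤ i ≤ p − 1`.  Let
`R = F_p[e_1,…,e_n]` be the invariant ring and
`J̃_n = ⟨e_1e_p − e_{p+1}, …, e_ie_p − e_{p+i}, e_{i+1}, …, e_{p−1}⟩ ⊂ R`.  Then the cofixed
space `F_p[x_1,…,x_n]_{S_n}` decomposes as an `R`-module as `R/J̃_n ⊕ J̃_n`. -/
theorem cofixed_Fp_decomposition (p : ℕ) [Fact p.Prime] (i : ℕ) (hi : i ≤ p - 1)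
    (J : Ideal (symmetricSubalgebra (Fin (p + i)) (ZMod p)))
    (hJ : J = Ideal.span
        (((fun j => eF p (p + i) j * eF p (p + i) p - eF p (p + i) (p + j)) ''
            Set.Icc 1 i) ∪
         ((fun j => eF p (p + i) j) '' Set.Icc (i + 1) (p - 1))))
    (N : Submodule (symmetricSubalgebra (Fin (p + i)) (ZMod p))
        (MvPolynomial (Fin (p + i)) (ZMod p)))
    (hN : N = Submodule.span _
        {x : MvPolynomial (Fin (p + i)) (ZMod p) |
          ∃ (f : MvPolynomial (Fin (p + i)) (ZMod p)) (σ : Equiv.Perm (Fin (p + i))),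
            x = f - rename (⇑σ) f}) :
    Nonempty
      ((MvPolynomial (Fin (p + i)) (ZMod p) ⧸ N) ≃ₗ[symmetricSubalgebra (Fin (p + i)) (ZMod p)]
        (((symmetricSubalgebra (Fin (p + i)) (ZMod p)) ⧸ J) × J)) := by
  have hi' : i < p := by
    have := (Fact.out : p.Prime).pos
    omega
  obtain rfl : J = Cofixed.relIdeal p i := hJ
  exact Cofixed.nonempty_quotient_equiv (R := symmetricSubalgebra (Fin (p + i)) (ZMod p))
    (M := MvPolynomial (Fin (p + i)) (ZMod p)) (N := N)
    (P := (symmetricSubalgebra (Fin (p + i)) (ZMod p) ⧸ Cofixed.relIdeal p i) ×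
      Cofixed.relIdeal p i)
    (Cofixed.exists_surjective_ker_eq hi' hN)
end
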